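/- arXiv:1507.04302 — 4 statements merged into one kernel-verified Lean document; each statement's English description precedes it below -/
import Mathlib

section
/- Transverse arcs have bounded convolution: there exists a constant C < ∞ such that for every j ≤ 0 and every pair of arcs (caps) C₁, C₂ ⊆ S¹ with the property that for every x ∈ C₁ and y ∈ C₂ both the angle between x and y and the angle between x and −y are at least 2^j, the convolution (χ_{C₁} σ) ∗ (χ_{C₂} σ) is an absolutely continuous measure on ℝ² whose density satisfies ‖(χ_{C₁} σ) ∗ (χ_{C₂} σ)‖_{L^∞(ℝ²)} ≤ C · 2^{−j}. -/
open MeasureTheory Filter Function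
open scoped ENNReal RealInnerProductSpace

noncomputable section

abbrev E2 := EuclideanSpace ℝ (Fin 2)

/-- Arc-length (1-dimensional Hausdorff) measure on the unit circle `S¹ ⊆ ℝ²`. -/
def sphMeas : Measure E2 := (μH[1]).restrict (Metric.sphere (0 : E2) 1)

/-- The cap `C(z, r)` on `S¹`. -/
def cap (z : E2) (r : ℝ) : Set E2 :=
  {y | y ∈ Metric.sphere (0 : E2) 1 ∧ 0 < (⟪z, y⟫ : ℝ) ∧
    ‖y - (⟪z, y⟫ : ℝ) • z‖ < r}

/-- The standard parametrization of the unit circle by the angle. -/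
def circlePoint (t : ℝ) : E2 := !₂[Real.cos t, Real.sin t]

lemma lipschitzWith_circlePoint : LipschitzWith 1 circlePoint := by
  refine LipschitzWith.of_dist_le_mul fun s t => ?_
  rw [NNReal.coe_one, one_mul, EuclideanSpace.dist_eq, Real.dist_eq]
  refine Real.sqrt_le_iff.2 ⟨abs_nonneg _, ?_⟩
  simp only [circlePoint, Fin.sum_univ_two, Real.dist_eq, sq_abs, PiLp.toLp_apply,
    Matrix.cons_val_zero, Matrix.cons_val_one]
  have h := Real.one_sub_sq_div_two_le_cos (x := s - t)
  rw [Real.cos_sub] at h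
  nlinarith [Real.sin_sq_add_cos_sq s, Real.sin_sq_add_cos_sq t]

lemma exists_circlePoint_eq {x : E2} (hx : x ∈ Metric.sphere (0 : E2) 1) :
    ∃ t ∈ Set.Ioc (-Real.pi) Real.pi, circlePoint t = x := by
  have hn : ‖(⟨x 0, x 1⟩ : ℂ)‖ = 1 := by
    have h : ‖x‖ = 1 := by simpa using hx
    rw [EuclideanSpace.norm_eq, Fin.sum_univ_two, Real.norm_eq_abs, Real.norm_eq_abs,
      sq_abs, sq_abs] at h
    rw [Complex.norm_def, Complex.normSq_mk, ← h]
    ring_nf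
  refine ⟨Complex.arg ⟨x 0, x 1⟩, Complex.arg_mem_Ioc _, ?_⟩
  have h0 := Complex.norm_mul_cos_arg ⟨x 0, x 1⟩
  have h1 := Complex.norm_mul_sin_arg ⟨x 0, x 1⟩
  rw [hn, one_mul] at h0 h1
  ext i
  fin_cases i
  · exact h0
  · exact h1

lemma injOn_circlePoint : Set.InjOn circlePoint (Set.Ioc (-Real.pi) Real.pi) := by
  intro s hs t ht h
  have h0 : Real.cos s = Real.cos t := congrArg (fun x : E2 => x 0) h
  have h1 : Real.sin s = Real.sin t := congrArg (fun x : E2 => x 1) h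
  rw [← Real.Angle.toReal_coe_eq_self_iff_mem_Ioc.2 hs, Real.Angle.cos_sin_inj h0 h1,
    Real.Angle.toReal_coe_eq_self_iff_mem_Ioc.2 ht]

/-- The angles in `(-π, π]` of the points of `S`. -/
def circleAngles (S : Set E2) : Set ℝ := Set.Ioc (-Real.pi) Real.pi ∩ circlePoint ⁻¹' S

lemma measurable_circlePoint : Measurable circlePoint :=
  lipschitzWith_circlePoint.continuous.measurable

lemma measurableSet_circleAngles {S : Set E2} (hS : MeasurableSet S) :
    MeasurableSet (circleAngles S) :=
  measurableSet_Ioc.inter (measurable_circlePoint hS)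

lemma sphMeas_restrict_le {S : Set E2} (hS : MeasurableSet S) :
    sphMeas.restrict S ≤ (volume.restrict (circleAngles S)).map circlePoint := by
  refine Measure.le_iff.2 fun A hA => ?_
  rw [Measure.map_apply measurable_circlePoint hA,
    Measure.restrict_apply (measurable_circlePoint hA), Measure.restrict_apply hA, sphMeas,
    Measure.restrict_apply (hA.inter hS)]
  calc μH[1] (A ∩ S ∩ Metric.sphere 0 1)
      ≤ μH[1] (circlePoint '' (circlePoint ⁻¹' A ∩ circleAngles S)) := by
        refine measure_mono ?_
        rintro x ⟨⟨hxA, hxS⟩, hx⟩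
        obtain ⟨t, ht, rfl⟩ := exists_circlePoint_eq hx
        exact ⟨t, ⟨hxA, ht, hxS⟩, rfl⟩
    _ ≤ volume (circlePoint ⁻¹' A ∩ circleAngles S) := by
        simpa [hausdorffMeasure_real] using
          lipschitzWith_circlePoint.hausdorffMeasure_image_le zero_le_one
            (circlePoint ⁻¹' A ∩ circleAngles S)

/-- The sum of two points of the unit circle, in coordinates. -/
def circleSum (p : ℝ × ℝ) : ℝ × ℝ :=
  (Real.cos p.1 + Real.cos p.2, Real.sin p.1 + Real.sin p.2)

/-- The derivative of `circleSum`. -/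
def fderivCircleSum (p : ℝ × ℝ) : ℝ × ℝ →L[ℝ] ℝ × ℝ :=
  LinearMap.toContinuousLinearMap (Matrix.toLin (Module.Basis.finTwoProd ℝ)
    (Module.Basis.finTwoProd ℝ)
    !![-Real.sin p.1, -Real.sin p.2; Real.cos p.1, Real.cos p.2])

lemma hasFDerivAt_circleSum (p : ℝ × ℝ) : HasFDerivAt circleSum (fderivCircleSum p) p := by
  unfold fderivCircleSum
  rw [Matrix.toLin_finTwoProd_toContinuousLinearMap]
  exact (hasFDerivAt_fst.cos.add hasFDerivAt_snd.cos).prodMk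
    (hasFDerivAt_fst.sin.add hasFDerivAt_snd.sin)

lemma det_fderivCircleSum (p : ℝ × ℝ) :
    (fderivCircleSum p).det =
      Real.cos p.1 * Real.sin p.2 - Real.sin p.1 * Real.cos p.2 := by
  simp only [fderivCircleSum, LinearMap.det_toContinuousLinearMap, LinearMap.det_toLin,
    Matrix.det_fin_two_of]
  ring

/-- Two pairs of unit vectors with the same sum agree up to order, if the first pair is
linearly independent. -/
lemma eq_or_eq_of_add_eq_add {a b c d a' b' c' d' : ℝ}
    (hx : a ^ 2 + b ^ 2 = 1) (hy : c ^ 2 + d ^ 2 = 1)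
    (hx' : a' ^ 2 + b' ^ 2 = 1) (hy' : c' ^ 2 + d' ^ 2 = 1)
    (h0 : a + c = a' + c') (h1 : b + d = b' + d') (hdet : a * d - b * c ≠ 0) :
    (a' = a ∧ b' = b) ∨ (a' = c ∧ b' = d) := by
  obtain ⟨α, hα⟩ : ∃ α, α = (a' * d - b' * c) / (a * d - b * c) := ⟨_, rfl⟩
  obtain ⟨β, hβ⟩ : ∃ β, β = (a * b' - b * a') / (a * d - b * c) := ⟨_, rfl⟩
  have ha' : a' = α * a + β * c := by
    rw [hα, hβ, div_mul_eq_mul_div, div_mul_eq_mul_div, ← add_div, eq_div_iff hdet]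
    ring
  have hb' : b' = α * b + β * d := by
    rw [hα, hβ, div_mul_eq_mul_div, div_mul_eq_mul_div, ← add_div, eq_div_iff hdet]
    ring
  have hc' : c' = (1 - α) * a + (1 - β) * c := by linarith
  have hd' : d' = (1 - α) * b + (1 - β) * d := by linarith
  have hlag : (1 + (a * c + b * d)) * (1 - (a * c + b * d)) = (a * d - b * c) ^ 2 := by
    linear_combination -hy * (a ^ 2 + b ^ 2) - hx
  have hprod : (1 + (a * c + b * d)) * (1 - (a * c + b * d)) ≠ 0 := by
    rw [hlag]; exact pow_ne_zero 2 hdet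
  have hplus := left_ne_zero_of_mul hprod
  have hminus := right_ne_zero_of_mul hprod
  subst ha' hb' hc' hd'
  have hsum : β = 1 - α := by
    have : (1 + (a * c + b * d)) * (1 - α - β) = 0 := by
      linear_combination (hy' - hx' - (1 - 2 * α) * hx - (1 - 2 * β) * hy) / 2
    linarith [(mul_eq_zero.1 this).resolve_left hplus]
  subst hsum
  have : α * (α - 1) * (1 - (a * c + b * d)) = 0 := by
    linear_combination (hx' - α ^ 2 * hx - (1 - α) ^ 2 * hy) / 2
  rcases mul_eq_zero.1 ((mul_eq_zero.1 this).resolve_right hminus) with h | h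
  · right; subst h; constructor <;> ring
  · left
    obtain rfl : α = 1 := by linarith
    constructor <;> ring

lemma injOn_circleSum {S₁ S₂ : Set E2} {c : ℝ} (hc : 0 < c)
    (h : ∀ x ∈ S₁, ∀ y ∈ S₂, c ≤ |x 0 * y 1 - x 1 * y 0|) :
    Set.InjOn circleSum (circleAngles S₁ ×ˢ circleAngles S₂) := by
  rintro ⟨s, t⟩ ⟨⟨hs, hs₁⟩, ⟨ht, ht₂⟩⟩ ⟨s', t'⟩ ⟨⟨hs', hs₁'⟩, ⟨ht', ht₂'⟩⟩ heq
  have h0 : Real.cos s + Real.cos t = Real.cos s' + Real.cos t' := congrArg Prod.fst heq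
  have h1 : Real.sin s + Real.sin t = Real.sin s' + Real.sin t' := congrArg Prod.snd heq
  have hdet : Real.cos s * Real.sin t - Real.sin s * Real.cos t ≠ 0 :=
    abs_pos.1 (hc.trans_le (h _ hs₁ _ ht₂))
  rcases eq_or_eq_of_add_eq_add (Real.cos_sq_add_sin_sq s) (Real.cos_sq_add_sin_sq t)
    (Real.cos_sq_add_sin_sq s') (Real.cos_sq_add_sin_sq t') h0 h1 hdet with ⟨e0, e1⟩ | ⟨e0, e1⟩
  · have e : circlePoint s = circlePoint s' := by simp [circlePoint, e0, e1]
    have f : circlePoint t = circlePoint t' := by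
      simp only [circlePoint, show Real.cos t = Real.cos t' by linarith,
        show Real.sin t = Real.sin t' by linarith]
    exact Prod.ext (injOn_circlePoint hs hs' e) (injOn_circlePoint ht ht' f)
  · have e : circlePoint s' = circlePoint t := by simp [circlePoint, e0, e1]
    have hst : circlePoint t ∈ S₁ := e ▸ hs₁'
    have := h _ hst _ ht₂
    rw [mul_comm (circlePoint t 0), sub_self, abs_zero] at this
    linarith

lemma measurePreserving_toLp_prod :
    MeasurePreserving (fun p : ℝ × ℝ => (!₂[p.1, p.2] : E2)) :=
  (PiLp.volume_preserving_toLp (Fin 2)).comp (volume_preserving_finTwoArrow ℝ).symm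

/-- If all pairs in `S₁ × S₂` span parallelograms of area at least `c`, then the convolution of
the restrictions of arc length to `S₁` and `S₂` has density at most `c⁻¹`. -/
lemma sphMeas_restrict_conv_le {S₁ S₂ : Set E2} (hS₁ : MeasurableSet S₁)
    (hS₂ : MeasurableSet S₂) {c : ℝ} (hc : 0 < c)
    (h : ∀ x ∈ S₁, ∀ y ∈ S₂, c ≤ |x 0 * y 1 - x 1 * y 0|) :
    (sphMeas.restrict S₁).conv (sphMeas.restrict S₂) ≤
      ENNReal.ofReal c⁻¹ • (volume : Measure E2) := by
  refine Measure.le_iff.2 fun A hA => ?_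
  have hcont : Continuous circleSum := by unfold circleSum; fun_prop
  obtain ⟨B, hB⟩ : ∃ B, B = (fun p : ℝ × ℝ => (!₂[p.1, p.2] : E2)) ⁻¹' A := ⟨_, rfl⟩
  have hBm : MeasurableSet B := hB ▸ measurePreserving_toLp_prod.measurable hA
  have hBvol : volume B = volume A := by
    rw [hB, measurePreserving_toLp_prod.measure_preimage hA.nullMeasurableSet]
  obtain ⟨T, hT⟩ : ∃ T, T = circleSum ⁻¹' B ∩ (circleAngles S₁ ×ˢ circleAngles S₂) := ⟨_, rfl⟩
  have hTm : MeasurableSet T := hT ▸ (hcont.measurable hBm).inter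
    ((measurableSet_circleAngles hS₁).prod (measurableSet_circleAngles hS₂))
  have hle : ENNReal.ofReal c * volume T ≤ volume A := by
    calc ENNReal.ofReal c * volume T
        = ∫⁻ _ in T, ENNReal.ofReal c := by rw [setLIntegral_const]
      _ ≤ ∫⁻ p in T, ENNReal.ofReal |(fderivCircleSum p).det| := by
          refine setLIntegral_mono' hTm fun p hp => ENNReal.ofReal_le_ofReal ?_
          rw [hT] at hp
          rw [det_fderivCircleSum]
          exact h _ hp.2.1.2 _ hp.2.2.2
      _ = volume (circleSum '' T) :=
          lintegral_abs_det_fderiv_eq_addHaar_image volume hTm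
            (fun p _ => (hasFDerivAt_circleSum p).hasFDerivWithinAt)
            ((injOn_circleSum hc h).mono (hT ▸ Set.inter_subset_right))
      _ ≤ volume A := by
          rw [← hBvol, hT]
          exact measure_mono (Set.image_subset_iff.2 Set.inter_subset_left)
  calc (sphMeas.restrict S₁).conv (sphMeas.restrict S₂) A
      = ((sphMeas.restrict S₁).prod (sphMeas.restrict S₂)) ((fun p => p.1 + p.2) ⁻¹' A) :=
        Measure.map_apply (by fun_prop) hA
    _ ≤ (((volume.restrict (circleAngles S₁)).map circlePoint).prod
          ((volume.restrict (circleAngles S₂)).map circlePoint)) ((fun p => p.1 + p.2) ⁻¹' A) :=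
        Measure.prod_mono (sphMeas_restrict_le hS₁) (sphMeas_restrict_le hS₂) _
    _ = volume T := by
        rw [Measure.map_prod_map _ _ measurable_circlePoint measurable_circlePoint,
          Measure.map_apply (measurable_circlePoint.prodMap measurable_circlePoint)
            ((by fun_prop : Measurable fun p : E2 × E2 => p.1 + p.2) hA),
          Measure.prod_restrict, Measure.restrict_apply, ← Measure.volume_eq_prod, hT, hB]
        · congr 2
          ext p
          have : circlePoint p.1 + circlePoint p.2 = !₂[(circleSum p).1, (circleSum p).2] := by
            ext i
            fin_cases i <;> simp [circlePoint, circleSum]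
          simp [this]
        · exact (measurable_circlePoint.prodMap measurable_circlePoint)
            ((by fun_prop : Measurable fun p : E2 × E2 => p.1 + p.2) hA)
    _ = ENNReal.ofReal c⁻¹ * (ENNReal.ofReal c * volume T) := by
        rw [← mul_assoc, ← ENNReal.ofReal_mul (inv_nonneg.2 hc.le), inv_mul_cancel₀ hc.ne',
          ENNReal.ofReal_one, one_mul]
    _ ≤ (ENNReal.ofReal c⁻¹ • (volume : Measure E2)) A := by
        rw [Measure.smul_apply, smul_eq_mul]
        gcongr

lemma measurableSet_cap (z : E2) (r : ℝ) : MeasurableSet (cap z r) := by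
  refine Metric.isClosed_sphere.measurableSet.inter (MeasurableSet.inter ?_ ?_)
  · exact measurableSet_lt measurable_const
      (by fun_prop : Continuous fun y : E2 => (⟪z, y⟫ : ℝ)).measurable
  · exact measurableSet_lt
      (by fun_prop : Continuous fun y : E2 => ‖y - (⟪z, y⟫ : ℝ) • z‖).measurable measurable_const

open InnerProductGeometry in
lemma half_mul_le_abs_det_of_le_angle {x y : E2} (hx : x ∈ Metric.sphere (0 : E2) 1)
    (hy : y ∈ Metric.sphere (0 : E2) 1) {δ : ℝ} (hδ : 0 ≤ δ)
    (h : δ ≤ angle x y) (h' : δ ≤ angle x (-y)) :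
    δ / 2 ≤ |x 0 * y 1 - x 1 * y 0| := by
  have hsin : Real.sin (angle x y) = |x 0 * y 1 - x 1 * y 0| := by
    have hnx : ‖x‖ = 1 := by simpa using hx
    have hny : ‖y‖ = 1 := by simpa using hy
    have hcos := cos_angle x y
    rw [hnx, hny, mul_one, div_one] at hcos
    have hx2 : x 0 ^ 2 + x 1 ^ 2 = 1 := by
      simpa [Fin.sum_univ_two, hnx] using (EuclideanSpace.real_norm_sq_eq x).symm
    have hy2 : y 0 ^ 2 + y 1 ^ 2 = 1 := by
      simpa [Fin.sum_univ_two, hny] using (EuclideanSpace.real_norm_sq_eq y).symm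
    have hin : (⟪x, y⟫ : ℝ) = x 0 * y 0 + x 1 * y 1 := by
      simp [PiLp.inner_apply, Fin.sum_univ_two, mul_comm]
    rw [hin] at hcos
    rw [← abs_of_nonneg (sin_angle_nonneg x y), ← sq_eq_sq_iff_abs_eq_abs, Real.sin_sq, hcos]
    linear_combination -hy2 * (x 0 ^ 2 + x 1 ^ 2) - hx2
  rw [angle_neg_right] at h'
  have key : ∀ u : ℝ, δ ≤ u → u ≤ Real.pi / 2 → δ / 2 ≤ Real.sin u := fun u hu hu' => by
    have h1 := Real.mul_le_sin (hδ.trans hu) hu'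
    have h2 : (1 / 2 : ℝ) ≤ 2 / Real.pi := by
      rw [div_le_div_iff₀ two_pos Real.pi_pos]
      linarith [Real.pi_le_four]
    nlinarith
  rw [← hsin]
  rcases le_total (angle x y) (Real.pi / 2) with hle | hle
  · exact key _ h hle
  · rw [← Real.sin_pi_sub]
    exact key _ h' (by linarith)

/-- Transverse arcs have bounded convolution: if the angle between any `x ∈ C₁`,
`y ∈ C₂` and between any `x ∈ C₁`, `−y` is at least `2^j` (`j ≤ 0`), then
`(χ_{C₁}σ) ∗ (χ_{C₂}σ)` is absolutely continuous with density `≤ C 2^{-j}`. -/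
theorem transverse_arcs_convolution_bounded :
    ∃ C : ℝ, 0 < C ∧
      ∀ j : ℤ, j ≤ 0 →
      ∀ (z₁ z₂ : E2) (r₁ r₂ : ℝ),
        z₁ ∈ Metric.sphere (0 : E2) 1 → z₂ ∈ Metric.sphere (0 : E2) 1 →
        r₁ ∈ Set.Ioc (0 : ℝ) 1 → r₂ ∈ Set.Ioc (0 : ℝ) 1 →
        (∀ x ∈ cap z₁ r₁, ∀ y ∈ cap z₂ r₂,
          (2 : ℝ) ^ j ≤ InnerProductGeometry.angle x y ∧
          (2 : ℝ) ^ j ≤ InnerProductGeometry.angle x (-y)) →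
        (sphMeas.restrict (cap z₁ r₁)).conv (sphMeas.restrict (cap z₂ r₂)) ≪
            (volume : Measure E2) ∧
          ∀ᵐ x ∂(volume : Measure E2),
            ((sphMeas.restrict (cap z₁ r₁)).conv
                (sphMeas.restrict (cap z₂ r₂))).rnDeriv (volume : Measure E2) x ≤
              ENNReal.ofReal (C * (2 : ℝ) ^ (-j)) := by
  refine ⟨2, two_pos, fun j _ z₁ z₂ r₁ r₂ _ _ _ _ h => ?_⟩
  have hj : (0 : ℝ) < 2 ^ j := by positivity
  have hle := sphMeas_restrict_conv_le (measurableSet_cap z₁ r₁) (measurableSet_cap z₂ r₂)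
    (half_pos hj) fun x hx y hy =>
      half_mul_le_abs_det_of_le_angle hx.1 hy.1 hj.le (h x hx y hy).1 (h x hx y hy).2
  rw [inv_div, div_eq_mul_inv, ← zpow_neg] at hle
  refine ⟨(Measure.absolutelyContinuous_of_le hle).trans Measure.smul_absolutelyContinuous, ?_⟩
  refine ae_le_of_forall_setLIntegral_le_of_sigmaFinite (Measure.measurable_rnDeriv _ _)
    fun s _ _ => (Measure.setLIntegral_rnDeriv_le s).trans ?_
  rw [setLIntegral_const]
  exact hle s
end
end

section
/- Distant caps interact weakly: for every ε > 0 there exists ρ < ∞ such that for all caps C, C′ ⊆ S¹ with ϱ(C, C′) > ρ, one has ‖χ_C σ ∗ χ_C σ ∗ χ_{C′} σ‖_{L²(ℝ²)} ≤ ε · |C| · |C′|^{1/2}. -/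
open MeasureTheory Filter Function
open scoped ENNReal RealInnerProductSpace

noncomputable section

/-- `ρ(C(z,r), C(z',r')) = r/r' + r'/r + |z − z'|/r`. -/
def capDist (z : E2) (r : ℝ) (z' : E2) (r' : ℝ) : ℝ :=
  r / r' + r' / r + ‖z - z'‖ / r

/-- `ϱ(C, C') = min(ρ(C, C'), ρ(−C, C'))`, where `−C(z,r) = C(−z,r)`. -/
def capDistAntipodal (z : E2) (r : ℝ) (z' : E2) (r' : ℝ) : ℝ :=
  min (capDist z r z' r') (capDist (-z) r z' r')

/-- The arc-length parametrization of the unit circle. -/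
def circ (a : ℝ) : E2 := !₂[Real.cos a, Real.sin a]

lemma circ_zero (a : ℝ) : circ a 0 = Real.cos a := rfl

lemma circ_one (a : ℝ) : circ a 1 = Real.sin a := rfl

lemma continuous_circ : Continuous circ := by
  unfold circ
  refine (PiLp.continuous_toLp 2 _).comp ?_
  refine continuous_pi fun i => ?_
  fin_cases i
  · exact Real.continuous_cos
  · exact Real.continuous_sin

lemma E2.inner_eq (x y : E2) : (⟪x, y⟫ : ℝ) = x 0 * y 0 + x 1 * y 1 := by
  simp [PiLp.inner_apply, Fin.sum_univ_two]; ring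

lemma E2.norm_sq_eq (x : E2) : ‖x‖ ^ 2 = x 0 ^ 2 + x 1 ^ 2 := by
  rw [← real_inner_self_eq_norm_sq, E2.inner_eq]; ring

lemma exists_circ_eq {y : E2} (hy : ‖y‖ = 1) : ∃ a ∈ Set.Ioc (-Real.pi) Real.pi, circ a = y := by
  have h := E2.norm_sq_eq y
  rw [hy] at h
  have hw : ‖(⟨y 0, y 1⟩ : ℂ)‖ = 1 := by
    rw [Complex.norm_def, Complex.normSq_mk, Real.sqrt_eq_one]
    nlinarith
  have h0 : (⟨y 0, y 1⟩ : ℂ) ≠ 0 := by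
    intro h0
    rw [h0] at hw
    simp at hw
  refine ⟨Complex.arg ⟨y 0, y 1⟩, Complex.arg_mem_Ioc _, ?_⟩
  ext i
  fin_cases i
  · change Real.cos _ = y 0
    rw [Complex.cos_arg h0, hw, div_one]
  · change Real.sin _ = y 1
    rw [Complex.sin_arg, hw, div_one]

lemma lipschitzWith_circ : LipschitzWith 1 circ := by
  refine LipschitzWith.of_dist_le_mul fun a b => ?_
  rw [NNReal.coe_one, one_mul, dist_eq_norm, Real.dist_eq]
  refine abs_le_of_sq_le_sq' ?_ (abs_nonneg _) |>.2
  rw [E2.norm_sq_eq, sq_abs]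
  simp only [PiLp.sub_apply, circ_zero, circ_one]
  have := Real.one_sub_sq_div_two_le_cos (x := a - b)
  rw [Real.cos_sub] at this
  nlinarith [Real.cos_sq_add_sin_sq a, Real.cos_sq_add_sin_sq b]

/-- Lebesgue measure on a fundamental interval of angles. -/
def angleMeas : Measure ℝ := volume.restrict (Set.Ioc (-Real.pi) Real.pi)

instance : IsFiniteMeasure angleMeas := by
  unfold angleMeas; infer_instance

lemma sphMeas_le_map_angleMeas : sphMeas ≤ angleMeas.map circ := by
  refine Measure.le_iff.2 fun s hs => ?_
  rw [Measure.map_apply continuous_circ.measurable hs, angleMeas, sphMeas,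
    Measure.restrict_apply hs, Measure.restrict_apply (continuous_circ.measurable hs)]
  have h1 : s ∩ Metric.sphere (0 : E2) 1 ⊆ circ '' (circ ⁻¹' s ∩ Set.Ioc (-Real.pi) Real.pi) := by
    rintro y ⟨hy, hy1⟩
    obtain ⟨a, ha, rfl⟩ := exists_circ_eq (mem_sphere_zero_iff_norm.1 hy1)
    exact ⟨a, ⟨hy, ha⟩, rfl⟩
  refine (measure_mono h1).trans ?_
  have h2 := lipschitzWith_circ.hausdorffMeasure_image_le (d := 1) zero_le_one
    (circ ⁻¹' s ∩ Set.Ioc (-Real.pi) Real.pi)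
  simpa [hausdorffMeasure_real] using h2

/-- The set of angles of a cap. -/
def capAngles (z : E2) (r : ℝ) : Set ℝ := circ ⁻¹' cap z r

lemma measurableSet_capAngles (z : E2) (r : ℝ) : MeasurableSet (capAngles z r) :=
  continuous_circ.measurable (measurableSet_cap z r)

lemma sphMeas_restrict_cap_le (z : E2) (r : ℝ) :
    sphMeas.restrict (cap z r) ≤ (angleMeas.restrict (capAngles z r)).map circ := by
  rw [capAngles, ← Measure.restrict_map continuous_circ.measurable (measurableSet_cap z r)]
  exact Measure.restrict_mono le_rfl sphMeas_le_map_angleMeas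

instance : IsFiniteMeasure sphMeas :=
  isFiniteMeasure_of_le _ sphMeas_le_map_angleMeas

lemma two_mul_le_sphMeas_cap {z : E2} (hz : ‖z‖ = 1) {r : ℝ} (hr1 : r ≤ 1) :
    ENNReal.ofReal (2 * r) ≤ sphMeas (cap z r) := by
  have hzz := E2.norm_sq_eq z
  rw [hz] at hzz
  have hnorm : ∀ x y : ℝ, ‖(!₂[x, y] : E2)‖ ^ 2 = x ^ 2 + y ^ 2 := fun x y => by
    rw [E2.norm_sq_eq]; rfl
  have hw : ‖(!₂[-z 1, z 0] : E2)‖ = 1 := by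
    have := hnorm (-z 1) (z 0)
    nlinarith [norm_nonneg (!₂[-z 1, z 0] : E2)]
  set w : E2 := !₂[-z 1, z 0] with hwdef
  have hw0 : w 0 = -z 1 := rfl
  have hw1 : w 1 = z 0 := rfl
  have hlip : LipschitzWith 1 (fun y : E2 => (⟪w, y⟫ : ℝ)) := by
    refine LipschitzWith.of_dist_le_mul fun a b => ?_
    rw [NNReal.coe_one, one_mul, dist_eq_norm, dist_eq_norm, ← inner_sub_right]
    have := norm_inner_le_norm (𝕜 := ℝ) w (a - b)
    rwa [hw, one_mul] at this
  have himg : Set.Ioo (-r) r ⊆ (fun y : E2 => (⟪w, y⟫ : ℝ)) '' cap z r := by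
    intro u hu
    have hu1 : u ^ 2 < 1 := by
      rw [sq_lt_one_iff_abs_lt_one, abs_lt]
      exact ⟨by linarith [hu.1], by linarith [hu.2]⟩
    set c := Real.sqrt (1 - u ^ 2) with hc
    have hcpos : 0 < c := Real.sqrt_pos.2 (by linarith)
    have hc2 : c ^ 2 = 1 - u ^ 2 := Real.sq_sqrt (by linarith)
    have hzy : (⟪z, c • z + u • w⟫ : ℝ) = c := by
      rw [E2.inner_eq]
      simp only [PiLp.add_apply, PiLp.smul_apply, smul_eq_mul, hw0, hw1]
      linear_combination -c * hzz
    refine ⟨c • z + u • w, ⟨?_, ?_, ?_⟩, ?_⟩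
    · rw [mem_sphere_zero_iff_norm]
      have : ‖c • z + u • w‖ ^ 2 = 1 := by
        rw [E2.norm_sq_eq]
        simp only [PiLp.add_apply, PiLp.smul_apply, smul_eq_mul, hw0, hw1]
        linear_combination hc2 - (c ^ 2 + u ^ 2) * hzz
      nlinarith [norm_nonneg (c • z + u • w)]
    · rw [hzy]; exact hcpos
    · rw [hzy, add_sub_cancel_left, norm_smul, hw, mul_one, Real.norm_eq_abs, abs_lt]
      exact hu
    · simp only [E2.inner_eq, PiLp.add_apply, PiLp.smul_apply, smul_eq_mul, hw0, hw1]
      linear_combination -u * hzz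
  calc ENNReal.ofReal (2 * r) = volume (Set.Ioo (-r) r) := by
        rw [Real.volume_Ioo]; congr 1; ring
    _ ≤ volume ((fun y : E2 => (⟪w, y⟫ : ℝ)) '' cap z r) := measure_mono himg
    _ ≤ μH[1] (cap z r) := by
        have h2 := hlip.hausdorffMeasure_image_le (d := 1) zero_le_one (cap z r)
        simpa [hausdorffMeasure_real] using h2
    _ = sphMeas (cap z r) := by
        rw [sphMeas, Measure.restrict_apply (measurableSet_cap z r),
          Set.inter_eq_left.2 fun y hy => hy.1]

/-- The Jacobian `|sin (a - b)|` of `(a, b) ↦ circ a + circ b`, as an extended nonnegative real. -/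
def sinDist (a b : ℝ) : ℝ≥0∞ := ENNReal.ofReal |Real.sin (a - b)|

lemma sinDist_comm (a b : ℝ) : sinDist a b = sinDist b a := by
  rw [sinDist, sinDist, ← neg_sub b a, Real.sin_neg, abs_neg]

@[fun_prop]
lemma Measurable.sinDist {α : Type*} [MeasurableSpace α] {f g : α → ℝ} (hf : Measurable f)
    (hg : Measurable g) : Measurable fun x => sinDist (f x) (g x) := by
  unfold _root_.sinDist
  refine ENNReal.measurable_ofReal.comp ?_
  exact (continuous_abs.comp Real.continuous_sin).measurable.comp (hf.sub hg)

lemma eq_of_cos_eq_of_sin_eq {a b : ℝ} (ha : a ∈ Set.Ioc (-Real.pi) Real.pi)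
    (hb : b ∈ Set.Ioc (-Real.pi) Real.pi) (hc : Real.cos a = Real.cos b)
    (hs : Real.sin a = Real.sin b) : a = b := by
  have h := Real.Angle.cos_sin_inj hc hs
  rw [← Real.Angle.toReal_coe_eq_self_iff_mem_Ioc.2 ha, h,
    Real.Angle.toReal_coe_eq_self_iff_mem_Ioc.2 hb]

/-- The sum map on pairs of angles, in coordinates. -/
def circSum (p : ℝ × ℝ) : ℝ × ℝ := (Real.cos p.1 + Real.cos p.2, Real.sin p.1 + Real.sin p.2)

/-- The derivative of `circSum`. -/
def fderivCircSum (p : ℝ × ℝ) : ℝ × ℝ →L[ℝ] ℝ × ℝ :=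
  (Matrix.toLin (.finTwoProd ℝ) (.finTwoProd ℝ)
    !![-Real.sin p.1, -Real.sin p.2; Real.cos p.1, Real.cos p.2]).toContinuousLinearMap

lemma hasFDerivAt_circSum (p : ℝ × ℝ) : HasFDerivAt circSum (fderivCircSum p) p := by
  unfold fderivCircSum
  rw [Matrix.toLin_finTwoProd_toContinuousLinearMap]
  exact HasFDerivAt.prodMk (𝕜 := ℝ)
    (((Real.hasDerivAt_cos p.1).comp_hasFDerivAt p hasFDerivAt_fst).add
      ((Real.hasDerivAt_cos p.2).comp_hasFDerivAt p hasFDerivAt_snd))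
    (((Real.hasDerivAt_sin p.1).comp_hasFDerivAt p hasFDerivAt_fst).add
      ((Real.hasDerivAt_sin p.2).comp_hasFDerivAt p hasFDerivAt_snd))

lemma abs_det_fderivCircSum (p : ℝ × ℝ) :
    |(fderivCircSum p).det| = |Real.sin (p.1 - p.2)| := by
  unfold fderivCircSum
  rw [LinearMap.det_toContinuousLinearMap, LinearMap.det_toLin, Matrix.det_fin_two_of,
    Real.sin_sub, ← abs_neg]
  congr 1
  ring

lemma circSum_injOn {U : Set (ℝ × ℝ)}
    (hU : U ⊆ Set.Ioc (-Real.pi) Real.pi ×ˢ Set.Ioc (-Real.pi) Real.pi)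
    (hsin : ∀ p ∈ U, ∀ q ∈ U, 0 < Real.sin (p.1 - p.2) * Real.sin (q.1 - q.2)) :
    Set.InjOn circSum U := by
  rintro ⟨a, b⟩ hp ⟨c, d⟩ hq h
  obtain ⟨ha, hb⟩ := hU hp
  obtain ⟨hc, hd⟩ := hU hq
  have hs := hsin _ hp _ hq
  simp only [circSum, Prod.mk.injEq] at h ha hb hc hd hs
  obtain ⟨h1, h2⟩ := h
  have hcos : Real.cos (a - b) = Real.cos (c - d) := by
    rw [Real.cos_sub, Real.cos_sub]
    have e1 : (Real.cos a + Real.cos b) ^ 2 + (Real.sin a + Real.sin b) ^ 2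
        = (Real.cos c + Real.cos d) ^ 2 + (Real.sin c + Real.sin d) ^ 2 := by rw [h1, h2]
    linear_combination e1 / 2 - (Real.cos_sq_add_sin_sq a + Real.cos_sq_add_sin_sq b
      - Real.cos_sq_add_sin_sq c - Real.cos_sq_add_sin_sq d) / 2
  have hs2 : Real.sin (a - b) = Real.sin (c - d) := by
    have e2 : Real.sin (a - b) ^ 2 = Real.sin (c - d) ^ 2 := by
      rw [Real.sin_sq, Real.sin_sq, hcos]
    rcases sq_eq_sq_iff_eq_or_eq_neg.1 e2 with e | e
    · exact e
    · rw [e] at hs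
      nlinarith [sq_nonneg (Real.sin (c - d))]
  have hpos : 0 < (1 + Real.cos (c - d)) ^ 2 + Real.sin (c - d) ^ 2 := by
    have : Real.sin (c - d) ≠ 0 := fun h0 => by rw [h0, mul_zero] at hs; exact lt_irrefl _ hs
    positivity
  have ea1 : Real.cos a = Real.cos (a - b) * Real.cos b - Real.sin (a - b) * Real.sin b := by
    rw [← Real.cos_add, sub_add_cancel]
  have ea2 : Real.sin a = Real.sin (a - b) * Real.cos b + Real.cos (a - b) * Real.sin b := by
    rw [← Real.sin_add, sub_add_cancel]
  have ec1 : Real.cos c = Real.cos (c - d) * Real.cos d - Real.sin (c - d) * Real.sin d := by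
    rw [← Real.cos_add, sub_add_cancel]
  have ec2 : Real.sin c = Real.sin (c - d) * Real.cos d + Real.cos (c - d) * Real.sin d := by
    rw [← Real.sin_add, sub_add_cancel]
  rw [hcos, hs2] at ea1 ea2
  rw [ea1, ec1] at h1
  rw [ea2, ec2] at h2
  generalize Real.cos (c - d) = C at *
  generalize Real.sin (c - d) = S at *
  have hbd1 : Real.cos b = Real.cos d := by
    refine mul_left_cancel₀ hpos.ne' ?_
    linear_combination (1 + C) * h1 + S * h2
  have hbd2 : Real.sin b = Real.sin d := by
    refine mul_left_cancel₀ hpos.ne' ?_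
    linear_combination (1 + C) * h2 - S * h1
  have hac1 : Real.cos a = Real.cos c := by rw [ea1, ec1, hbd1, hbd2]
  have hac2 : Real.sin a = Real.sin c := by rw [ea2, ec2, hbd1, hbd2]
  rw [eq_of_cos_eq_of_sin_eq ha hc hac1 hac2, eq_of_cos_eq_of_sin_eq hb hd hbd1 hbd2]

lemma setLIntegral_circSum_le {U : Set (ℝ × ℝ)} (hUm : MeasurableSet U)
    (hU : U ⊆ Set.Ioc (-Real.pi) Real.pi ×ˢ Set.Ioc (-Real.pi) Real.pi)
    (hsin : ∀ p ∈ U, ∀ q ∈ U, 0 < Real.sin (p.1 - p.2) * Real.sin (q.1 - q.2))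
    (ψ : ℝ × ℝ → ℝ≥0∞) :
    ∫⁻ p in U, sinDist p.1 p.2 * ψ (circSum p) ≤ ∫⁻ x, ψ x := by
  have h := lintegral_image_eq_lintegral_abs_det_fderiv_mul volume hUm
    (fun p _ => (hasFDerivAt_circSum p).hasFDerivWithinAt) (circSum_injOn hU hsin) ψ
  simp_rw [abs_det_fderivCircSum] at h
  exact h.symm.trans_le (setLIntegral_le_lintegral _ _)

lemma lintegral_toLp_prod (ψ : E2 → ℝ≥0∞) (hψ : Measurable ψ) :
    ∫⁻ q : ℝ × ℝ, ψ !₂[q.1, q.2] = ∫⁻ x, ψ x := by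
  have h1 := (PiLp.volume_preserving_toLp (Fin 2)).lintegral_comp hψ
  have h2 := (volume_preserving_finTwoArrow ℝ).symm.lintegral_comp
    (f := fun y : Fin 2 → ℝ => ψ (WithLp.toLp 2 y)) (hψ.comp (by fun_prop))
  rw [← h1, ← h2]
  rfl

/-- Pairs of angles add up to a point of the plane in at most two ways. -/
lemma lintegral_circ_add_circ_le (ψ : E2 → ℝ≥0∞) (hψ : Measurable ψ) :
    ∫⁻ p : ℝ × ℝ, sinDist p.1 p.2 * ψ (circ p.1 + circ p.2) ∂(angleMeas.prod angleMeas)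
      ≤ 2 * ∫⁻ x, ψ x := by
  rw [angleMeas, Measure.prod_restrict, ← Measure.volume_eq_prod]
  set Q := Set.Ioc (-Real.pi) Real.pi ×ˢ Set.Ioc (-Real.pi) Real.pi
  have hQ : MeasurableSet Q := measurableSet_Ioc.prod measurableSet_Ioc
  have hm : Measurable fun p : ℝ × ℝ => Real.sin (p.1 - p.2) := by fun_prop
  set P : Set (ℝ × ℝ) := Q ∩ {p | 0 < Real.sin (p.1 - p.2)}
  set N : Set (ℝ × ℝ) := Q ∩ {p | Real.sin (p.1 - p.2) < 0}
  have hP : MeasurableSet P := hQ.inter (measurableSet_lt measurable_const hm)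
  have hN : MeasurableSet N := hQ.inter (measurableSet_lt hm measurable_const)
  set Z : Set (ℝ × ℝ) := Q ∩ {p | Real.sin (p.1 - p.2) = 0}
  have hZ : MeasurableSet Z := hQ.inter (measurableSet_eq_fun hm measurable_const)
  have hcov : Q ⊆ (P ∪ N) ∪ Z := fun p hp => by
    rcases lt_trichotomy (Real.sin (p.1 - p.2)) 0 with h | h | h
    · exact Or.inl (Or.inr ⟨hp, h⟩)
    · exact Or.inr ⟨hp, h⟩
    · exact Or.inl (Or.inl ⟨hp, h⟩)
  have hsum : ∀ p : ℝ × ℝ, circ p.1 + circ p.2 = !₂[(circSum p).1, (circSum p).2] := fun p => by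
    ext i
    fin_cases i <;> rfl
  simp_rw [hsum]
  set f : ℝ × ℝ → ℝ≥0∞ := fun p => sinDist p.1 p.2 * ψ !₂[(circSum p).1, (circSum p).2]
  have hle : ∀ U : Set (ℝ × ℝ), MeasurableSet U → U ⊆ Q →
      (∀ p ∈ U, ∀ q ∈ U, 0 < Real.sin (p.1 - p.2) * Real.sin (q.1 - q.2)) →
      ∫⁻ p in U, f p ≤ ∫⁻ x, ψ x := fun U hUm hU hs => by
    rw [← lintegral_toLp_prod ψ hψ]
    exact setLIntegral_circSum_le hUm hU hs fun q => ψ !₂[q.1, q.2]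
  have h0 : ∫⁻ p in Z, f p = 0 := by
    refine (setLIntegral_congr_fun hZ fun p hp => ?_).trans (lintegral_zero)
    have : sinDist p.1 p.2 = 0 := by
      rw [sinDist, show Real.sin (p.1 - p.2) = 0 from hp.2, abs_zero, ENNReal.ofReal_zero]
    simp only [f, this, zero_mul]
  calc ∫⁻ p in Q, f p ≤ ∫⁻ p in (P ∪ N) ∪ Z, f p := lintegral_mono_set hcov
    _ ≤ ((∫⁻ p in P, f p) + (∫⁻ p in N, f p)) + ∫⁻ p in Z, f p :=
        (lintegral_union_le _ _ _).trans (add_le_add (lintegral_union_le _ _ _) le_rfl)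
    _ ≤ ((∫⁻ x, ψ x) + (∫⁻ x, ψ x)) + 0 := by
        refine add_le_add (add_le_add ?_ ?_) h0.le
        · exact hle P hP Set.inter_subset_left fun p hp q hq => mul_pos hp.2 hq.2
        · exact hle N hN Set.inter_subset_left fun p hp q hq => mul_pos_of_neg_of_neg hp.2 hq.2
    _ = 2 * ∫⁻ x, ψ x := by rw [add_zero, two_mul]

/-- An `L²` bound for a density, by duality. -/
lemma eLpNorm_rnDeriv_le {α : Type*} [MeasurableSpace α] {μ m : Measure α} [SigmaFinite μ]
    {K : ℝ≥0∞}
    (h : ∀ φ : α → ℝ≥0∞, Measurable φ →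
      ∫⁻ x, φ x ∂m ≤ K * (∫⁻ x, φ x ^ 2 ∂μ) ^ ((1 : ℝ) / 2)) :
    eLpNorm (fun x => (m.rnDeriv μ x).toReal) 2 μ ≤ K := by
  set f := m.rnDeriv μ with hf
  have hfm : Measurable f := Measure.measurable_rnDeriv m μ
  set F : ℕ → α → ℝ≥0∞ := fun n => (spanningSets μ n).indicator fun x => min (f x) n with hF
  have hFm : ∀ n, Measurable (F n) := fun n =>
    (hfm.min measurable_const).indicator (measurableSet_spanningSets μ n)
  have hFf : ∀ n x, F n x ≤ f x := fun n x =>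
    (Set.indicator_le_self (spanningSets μ n) (fun x => min (f x) n) x).trans (min_le_left _ _)
  have hbound : ∀ n, ∫⁻ x, F n x ^ 2 ∂μ ≤ K ^ 2 := by
    intro n
    set A := ∫⁻ x, F n x ^ 2 ∂μ with hA
    have hAtop : A ≠ ⊤ := by
      have hle : A ≤ ∫⁻ x, (spanningSets μ n).indicator (fun _ => (n : ℝ≥0∞) ^ 2) x ∂μ := by
        refine lintegral_mono fun x => ?_
        by_cases hx : x ∈ spanningSets μ n
        · simp only [hF, Set.indicator_of_mem hx]
          gcongr
          exact min_le_right _ _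
        · simp [hF, Set.indicator_of_notMem hx]
      rw [lintegral_indicator_const (measurableSet_spanningSets μ n)] at hle
      refine ne_top_of_le_ne_top ?_ hle
      exact ENNReal.mul_ne_top (by simp) (measure_spanningSets_lt_top μ n).ne
    have h1 : A ≤ K * A ^ ((1 : ℝ) / 2) := by
      refine le_trans ?_ (h (F n) (hFm n))
      calc A ≤ ∫⁻ x, f x * F n x ∂μ := by
            refine lintegral_mono fun x => ?_
            rw [sq]
            gcongr
            exact hFf n x
        _ = ∫⁻ x, F n x ∂(μ.withDensity f) :=
            (lintegral_withDensity_eq_lintegral_mul μ hfm (hFm n)).symm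
        _ ≤ ∫⁻ x, F n x ∂m := lintegral_mono' (Measure.withDensity_rnDeriv_le m μ) le_rfl
    rcases eq_or_ne A 0 with h0 | h0
    · rw [h0]; exact zero_le
    have hs0 : A ^ ((1 : ℝ) / 2) ≠ 0 := by simp [h0]
    have hst : A ^ ((1 : ℝ) / 2) ≠ ⊤ := by simp [hAtop]
    have hsq : A ^ ((1 : ℝ) / 2) * A ^ ((1 : ℝ) / 2) = A := by
      rw [← ENNReal.rpow_add _ _ h0 hAtop]; norm_num
    have h2 : A ^ ((1 : ℝ) / 2) ≤ K := by
      rw [← ENNReal.mul_le_mul_iff_left hs0 hst, hsq]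
      exact h1
    calc A = (A ^ ((1 : ℝ) / 2)) ^ 2 := by rw [sq, hsq]
      _ ≤ K ^ 2 := by gcongr
  have hlim : ∫⁻ x, f x ^ 2 ∂μ ≤ K ^ 2 := by
    have ht : Tendsto (fun n => ∫⁻ x, F n x ^ 2 ∂μ) atTop (nhds (∫⁻ x, f x ^ 2 ∂μ)) := by
      refine lintegral_tendsto_of_tendsto_of_monotone
        (fun n => ((hFm n).pow_const 2).aemeasurable) (ae_of_all _ fun x => ?_)
        (ae_of_all _ fun x => ?_)
      · intro n k hnk
        refine pow_le_pow_left' ?_ 2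
        by_cases hx : x ∈ spanningSets μ n
        · simp only [hF, Set.indicator_of_mem hx,
            Set.indicator_of_mem (monotone_spanningSets μ hnk hx)]
          gcongr
        · simp [hF, Set.indicator_of_notMem hx]
      · refine ((ENNReal.continuous_pow 2).tendsto _).comp ?_
        have h1 : Tendsto (fun n : ℕ => min (f x) (n : ℝ≥0∞)) atTop (nhds (min (f x) ⊤)) :=
          tendsto_const_nhds.min ENNReal.tendsto_nat_nhds_top
        rw [min_top_right] at h1
        refine h1.congr' ?_
        filter_upwards [eventually_ge_atTop (spanningSetsIndex μ x)] with n hn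
        change _ = (spanningSets μ n).indicator (fun x => min (f x) n) x
        rw [Set.indicator_of_mem (monotone_spanningSets μ hn (mem_spanningSetsIndex μ x))]
    exact le_of_tendsto' ht hbound
  rw [eLpNorm_eq_lintegral_rpow_enorm_toReal (by norm_num) (by norm_num)]
  simp only [ENNReal.toReal_ofNat]
  calc (∫⁻ x, ‖(f x).toReal‖ₑ ^ (2 : ℝ) ∂μ) ^ ((1 : ℝ) / 2) ≤ (K ^ 2) ^ ((1 : ℝ) / 2) := by
        gcongr
        refine le_trans (lintegral_mono fun x => ?_) hlim
        rw [ENNReal.rpow_two]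
        gcongr
        rw [Real.enorm_of_nonneg ENNReal.toReal_nonneg]
        exact ENNReal.ofReal_toReal_le
    _ = K := by
        rw [← ENNReal.rpow_two, ← ENNReal.rpow_mul]; norm_num

/-- The Cauchy-Schwarz inequality with a weight `S`. -/
lemma setLIntegral_le_weighted {α : Type*} [MeasurableSpace α] (μ : Measure α) {R : Set α}
    {f S : α → ℝ≥0∞} (hf : Measurable f) (hS : Measurable S)
    (hS_ne_top : ∀ x, S x ≠ ⊤) {Y : ℝ≥0∞} (hY : Y ≠ ⊤) (hSY : ∫⁻ x in R, (S x)⁻¹ ∂μ ≤ Y) :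
    ∫⁻ x in R, f x ∂μ ≤ Y ^ ((1 : ℝ) / 2) * (∫⁻ x, S x * f x ^ 2 ∂μ) ^ ((1 : ℝ) / 2) := by
  have hpos : ∀ᵐ x ∂(μ.restrict R), (S x)⁻¹ < ⊤ :=
    ae_lt_top hS.inv (ne_top_of_le_ne_top hY hSY)
  have hsq : ∀ a : ℝ≥0∞, (a ^ ((1 : ℝ) / 2)) ^ (2 : ℝ) = a := fun a => by
    rw [← ENNReal.rpow_mul]; norm_num
  calc ∫⁻ x in R, f x ∂μ
      = ∫⁻ x in R, ((fun x => ((S x)⁻¹) ^ ((1 : ℝ) / 2)) *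
          fun x => (S x) ^ ((1 : ℝ) / 2) * f x) x ∂μ := by
        refine lintegral_congr_ae ?_
        filter_upwards [hpos] with x hx
        have h0 : S x ≠ 0 := fun h => by simp [h] at hx
        rw [Pi.mul_apply, ← mul_assoc, ← ENNReal.mul_rpow_of_nonneg _ _ (by norm_num),
          ENNReal.inv_mul_cancel h0 (hS_ne_top x), ENNReal.one_rpow, one_mul]
    _ ≤ _ := ENNReal.lintegral_mul_le_Lp_mul_Lq _ (Real.HolderConjugate.two_two)
        (hS.inv.pow_const _).aemeasurable ((hS.pow_const _).mul hf).aemeasurable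
    _ ≤ Y ^ ((1 : ℝ) / 2) * (∫⁻ x, S x * f x ^ 2 ∂μ) ^ ((1 : ℝ) / 2) := by
        simp only [ENNReal.mul_rpow_of_nonneg _ _ zero_le_two, hsq, ENNReal.rpow_two]
        gcongr
        exact Measure.restrict_le_self

/-- If `v` is a frozen shift, the weighted `L²` norm in the two other angles is controlled. -/
lemma lintegral_prod_circ_add_circ_le {X : Type*} [MeasurableSpace X] (α : Measure X) [SFinite α]
    {β γ : Measure ℝ} [SFinite β] [SFinite γ] (hβ : β ≤ angleMeas) (hγ : γ ≤ angleMeas)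
    {v : X → E2} (hv : Measurable v) {φ : E2 → ℝ≥0∞} (hφ : Measurable φ) :
    ∫⁻ p : X × ℝ × ℝ, sinDist p.2.1 p.2.2 * φ (v p.1 + (circ p.2.1 + circ p.2.2)) ^ 2
        ∂(α.prod (β.prod γ)) ≤ 2 * (∫⁻ x, φ x ^ 2) * α Set.univ := by
  have hc := continuous_circ.measurable
  rw [lintegral_prod _ (by fun_prop)]
  calc _ ≤ ∫⁻ _ : X, 2 * (∫⁻ x, φ x ^ 2) ∂α := by
        refine lintegral_mono fun x => ?_
        refine (lintegral_mono' (Measure.prod_mono hβ hγ) le_rfl).trans ?_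
        refine (lintegral_circ_add_circ_le (fun y => φ (v x + y) ^ 2) (by fun_prop)).trans ?_
        rw [lintegral_add_left_eq_self (fun y => φ y ^ 2) (v x)]
    _ = _ := by rw [lintegral_const]

/-- The inverse square root of `sinDist`. -/
def sinWeight (a b : ℝ) : ℝ≥0∞ := sinDist a b ^ (-(1 / 2) : ℝ)

lemma rpow_neg_half_le_rpow_neg_half {x y : ℝ≥0∞} (h : x ≤ y) :
    y ^ (-(1 / 2) : ℝ) ≤ x ^ (-(1 / 2) : ℝ) := by
  rw [ENNReal.rpow_neg, ENNReal.rpow_neg]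
  gcongr

lemma sinWeight_comm (a b : ℝ) : sinWeight a b = sinWeight b a := by
  rw [sinWeight, sinWeight, sinDist_comm]

@[fun_prop]
lemma Measurable.sinWeight {α : Type*} [MeasurableSpace α] {f g : α → ℝ} (hf : Measurable f)
    (hg : Measurable g) : Measurable fun x => sinWeight (f x) (g x) := by
  unfold _root_.sinWeight
  exact (hf.sinDist hg).pow_const _

/-- The truncation of `sinWeight` to pairs of angles with `sinDist` less than `q ^ 2`. -/
def nearWeight (q a b : ℝ) : ℝ≥0∞ :=
  if sinDist a b < ENNReal.ofReal (q ^ 2) then sinWeight a b else 0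

lemma measurable_nearWeight {α : Type*} [MeasurableSpace α] (q : ℝ) {f g : α → ℝ}
    (hf : Measurable f) (hg : Measurable g) : Measurable fun x => nearWeight q (f x) (g x) := by
  unfold nearWeight
  exact Measurable.ite (measurableSet_lt (hf.sinDist hg) measurable_const)
    (hf.sinWeight hg) measurable_const

lemma lintegral_Icc_rpow_neg_half {q : ℝ} (hq : 0 ≤ q) :
    ∫⁻ u in Set.Icc 0 (2 * q ^ 2), ENNReal.ofReal (u / 2) ^ (-(1 / 2) : ℝ)
      = ENNReal.ofReal (4 * q) := by
  have h2q : (0 : ℝ) ≤ 2 * q ^ 2 := by positivity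
  rw [← restrict_Ioc_eq_restrict_Icc]
  have h1 : ∫⁻ u in Set.Ioc 0 (2 * q ^ 2), ENNReal.ofReal (u / 2) ^ (-(1 / 2) : ℝ)
      = ∫⁻ u in Set.Ioc 0 (2 * q ^ 2), ENNReal.ofReal (√2 * u ^ (-(1 / 2) : ℝ)) := by
    refine setLIntegral_congr_fun measurableSet_Ioc fun u hu => ?_
    have hu0 : 0 < u := hu.1
    rw [ENNReal.ofReal_rpow_of_pos (by positivity), Real.div_rpow hu0.le zero_le_two,
      Real.rpow_neg zero_le_two, ← Real.sqrt_eq_rpow, div_inv_eq_mul, mul_comm]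
  have hint : IntervalIntegrable (fun u : ℝ => √2 * u ^ (-(1 / 2) : ℝ)) volume 0 (2 * q ^ 2) :=
    (intervalIntegral.intervalIntegrable_rpow' (by norm_num)).const_mul _
  rw [h1, ← ofReal_integral_eq_lintegral_ofReal, ← intervalIntegral.integral_of_le h2q,
    intervalIntegral.integral_const_mul, integral_rpow (Or.inl (by norm_num))]
  · congr 1
    norm_num
    rw [← Real.sqrt_eq_rpow, Real.sqrt_mul zero_le_two, Real.sqrt_sq hq]
    have := Real.mul_self_sqrt (zero_le_two (α := ℝ))
    linear_combination 2 * q * this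
  · exact (intervalIntegrable_iff_integrableOn_Ioc_of_le h2q).1 hint
  · refine (ae_restrict_iff' measurableSet_Ioc).2 (ae_of_all _ fun u hu => ?_)
    have := hu.1
    positivity

lemma exists_half_abs_sub_le_abs_sin {y : ℝ} (hy : |y| < 2 * Real.pi) :
    ∃ k ∈ Finset.Icc (-2 : ℤ) 2, |y - k * Real.pi| / 2 ≤ |Real.sin y| := by
  have hpi := Real.pi_pos
  have hr := abs_sub_round (y / Real.pi)
  have hyp : |y / Real.pi| < 2 := by
    rw [abs_div, abs_of_pos hpi, div_lt_iff₀ hpi]; exact hy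
  refine ⟨round (y / Real.pi), ?_, ?_⟩
  · rw [abs_le] at hr
    rw [abs_lt] at hyp
    rw [Finset.mem_Icc]
    constructor
    · have : ((-3 : ℤ) : ℝ) < (round (y / Real.pi) : ℝ) := by push_cast; linarith
      have := Int.cast_lt.1 this
      omega
    · have : (round (y / Real.pi) : ℝ) < ((3 : ℤ) : ℝ) := by push_cast; linarith
      have := Int.cast_lt.1 this
      omega
  · generalize round (y / Real.pi) = k at *
    have hu : |y - k * Real.pi| ≤ Real.pi / 2 := by
      have : y - k * Real.pi = (y / Real.pi - k) * Real.pi := by field_simp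
      rw [this, abs_mul, abs_of_pos hpi]
      nlinarith
    have h1 := Real.mul_abs_le_abs_sin hu
    rw [Real.sin_sub_int_mul_pi, abs_mul, abs_zpow, abs_neg, abs_one, one_zpow, one_mul] at h1
    refine le_trans ?_ h1
    rw [div_eq_mul_inv, mul_comm]
    gcongr
    rw [inv_eq_one_div, div_le_div_iff₀ two_pos hpi]
    linarith [Real.pi_le_four]

lemma lintegral_nearWeight_le {q x : ℝ} (hq : 0 ≤ q) (hx : x ∈ Set.Ioc (-Real.pi) Real.pi) :
    ∫⁻ a, nearWeight q a x ∂angleMeas ≤ ENNReal.ofReal (40 * q) := by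
  set G : ℝ → ℝ≥0∞ := (Set.Icc 0 (2 * q ^ 2)).indicator
    fun u => ENNReal.ofReal (u / 2) ^ (-(1 / 2) : ℝ) with hG
  have hGm : Measurable G := Measurable.indicator (by fun_prop) measurableSet_Icc
  have hGint : ∫⁻ u, G u = ENNReal.ofReal (4 * q) := by
    rw [hG, lintegral_indicator measurableSet_Icc, lintegral_Icc_rpow_neg_half hq]
  have hpt : ∀ a ∈ Set.Ioc (-Real.pi) Real.pi, nearWeight q a x ≤
      ∑ k ∈ Finset.Icc (-2 : ℤ) 2, (G (a - (x + k * Real.pi)) + G ((x + k * Real.pi) - a)) := by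
    intro a ha
    rw [nearWeight]
    split_ifs with h
    swap
    · exact zero_le
    have hlt : |Real.sin (a - x)| < q ^ 2 := (ENNReal.ofReal_lt_ofReal_iff'.1 h).1
    obtain ⟨k, hk, hks⟩ := exists_half_abs_sub_le_abs_sin (y := a - x)
      (by rw [abs_lt]; constructor <;> linarith [ha.1, ha.2, hx.1, hx.2])
    rw [sub_sub] at hks
    refine le_trans ?_ (Finset.single_le_sum
      (f := fun k : ℤ => G (a - (x + k * Real.pi)) + G ((x + k * Real.pi) - a))
      (fun _ _ => zero_le) hk)
    have hmain : sinWeight a x ≤ G |a - (x + k * Real.pi)| := by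
      have hmem : |a - (x + k * Real.pi)| ∈ Set.Icc 0 (2 * q ^ 2) :=
        ⟨abs_nonneg _, by linarith⟩
      rw [hG, Set.indicator_of_mem hmem, sinWeight]
      exact rpow_neg_half_le_rpow_neg_half (ENNReal.ofReal_le_ofReal hks)
    refine hmain.trans ?_
    rcases abs_choice (a - (x + k * Real.pi)) with h | h
    · rw [h]; exact le_self_add
    · rw [h, neg_sub]; exact le_add_self
  calc ∫⁻ a, nearWeight q a x ∂angleMeas
      ≤ ∫⁻ a, ∑ k ∈ Finset.Icc (-2 : ℤ) 2,
          (G (a - (x + k * Real.pi)) + G ((x + k * Real.pi) - a)) ∂angleMeas :=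
        setLIntegral_mono' measurableSet_Ioc hpt
    _ ≤ ∫⁻ a, ∑ k ∈ Finset.Icc (-2 : ℤ) 2,
          (G (a - (x + k * Real.pi)) + G ((x + k * Real.pi) - a)) :=
        setLIntegral_le_lintegral _ _
    _ = ∑ k ∈ Finset.Icc (-2 : ℤ) 2, (ENNReal.ofReal (4 * q) + ENNReal.ofReal (4 * q)) := by
        rw [lintegral_finsetSum _ (fun k _ => by fun_prop)]
        refine Finset.sum_congr rfl fun k _ => ?_
        rw [lintegral_add_left (by fun_prop), lintegral_sub_right_eq_self,
          lintegral_sub_left_eq_self, hGint]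
    _ = ENNReal.ofReal (40 * q) := by
        rw [Finset.sum_const, ← ENNReal.ofReal_add (by positivity) (by positivity),
          ← ENNReal.ofReal_nsmul]
        congr 1
        rw [show (Finset.Icc (-2 : ℤ) 2).card = 5 from rfl]
        norm_num
        ring

lemma angleMeas_sinDist_lt_le {q x : ℝ} (hq : 0 < q) (hx : x ∈ Set.Ioc (-Real.pi) Real.pi) :
    angleMeas {a | sinDist a x < ENNReal.ofReal (q ^ 2)} ≤ ENNReal.ofReal (40 * q ^ 2) := by
  have hm : MeasurableSet {a | sinDist a x < ENNReal.ofReal (q ^ 2)} :=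
    measurableSet_lt (by fun_prop) measurable_const
  calc angleMeas {a | sinDist a x < ENNReal.ofReal (q ^ 2)}
      = ∫⁻ a, Set.indicator {a | sinDist a x < ENNReal.ofReal (q ^ 2)} 1 a ∂angleMeas :=
        (lintegral_indicator_one hm).symm
    _ ≤ ∫⁻ a, ENNReal.ofReal q * nearWeight q a x ∂angleMeas := by
        refine lintegral_mono fun a => ?_
        by_cases ha : sinDist a x < ENNReal.ofReal (q ^ 2)
        · rw [Set.indicator_of_mem (by exact ha), nearWeight, if_pos ha, sinWeight, Pi.one_apply]
          calc (1 : ℝ≥0∞) = ENNReal.ofReal q * ENNReal.ofReal (q ^ 2) ^ (-(1 / 2) : ℝ) := by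
                rw [ENNReal.ofReal_rpow_of_pos (by positivity), ← Real.rpow_natCast,
                  ← Real.rpow_mul hq.le, ← ENNReal.ofReal_mul hq.le]
                norm_num
                rw [Real.rpow_neg_one, mul_inv_cancel₀ hq.ne', ENNReal.ofReal_one]
            _ ≤ _ := by
                gcongr ENNReal.ofReal q * ?_
                exact rpow_neg_half_le_rpow_neg_half ha.le
        · rw [Set.indicator_of_notMem (by exact ha)]
          exact zero_le
    _ = ENNReal.ofReal q * ∫⁻ a, nearWeight q a x ∂angleMeas :=
        lintegral_const_mul _ (measurable_nearWeight q measurable_id measurable_const)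
    _ ≤ ENNReal.ofReal q * ENNReal.ofReal (40 * q) := by
        gcongr
        exact lintegral_nearWeight_le hq.le hx
    _ = ENNReal.ofReal (40 * q ^ 2) := by
        rw [← ENNReal.ofReal_mul hq.le]; congr 1; ring

lemma sinWeight_le_of_le {q a b : ℝ} (hq : 0 < q) (h : ENNReal.ofReal (q ^ 2) ≤ sinDist a b) :
    sinWeight a b ≤ ENNReal.ofReal q⁻¹ := by
  calc sinWeight a b ≤ ENNReal.ofReal (q ^ 2) ^ (-(1 / 2) : ℝ) :=
        rpow_neg_half_le_rpow_neg_half h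
    _ = ENNReal.ofReal q⁻¹ := by
        rw [ENNReal.ofReal_rpow_of_pos (by positivity), ← Real.rpow_natCast, ← Real.rpow_mul hq.le]
        norm_num
        rw [Real.rpow_neg_one]

lemma lintegral_sinWeight_le {β : Measure ℝ} (hβ : β ≤ angleMeas) {q x : ℝ} (hq : 0 < q)
    (hβq : β Set.univ ≤ ENNReal.ofReal (40 * q ^ 2)) (hx : x ∈ Set.Ioc (-Real.pi) Real.pi) :
    ∫⁻ a, sinWeight a x ∂β ≤ ENNReal.ofReal (80 * q) := by
  calc ∫⁻ a, sinWeight a x ∂β ≤ ∫⁻ a, (nearWeight q a x + ENNReal.ofReal q⁻¹) ∂β := by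
        refine lintegral_mono fun a => ?_
        by_cases ha : sinDist a x < ENNReal.ofReal (q ^ 2)
        · rw [nearWeight, if_pos ha]
          exact le_self_add
        · exact (sinWeight_le_of_le hq (not_lt.1 ha)).trans le_add_self
    _ = ∫⁻ a, nearWeight q a x ∂β + ENNReal.ofReal q⁻¹ * β Set.univ := by
        rw [lintegral_add_right _ measurable_const, lintegral_const]
    _ ≤ ENNReal.ofReal (40 * q) + ENNReal.ofReal q⁻¹ * ENNReal.ofReal (40 * q ^ 2) := by
        gcongr
        exact (lintegral_mono' hβ le_rfl).trans (lintegral_nearWeight_le hq.le hx)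
    _ = ENNReal.ofReal (80 * q) := by
        rw [← ENNReal.ofReal_mul (by positivity), ← ENNReal.ofReal_add (by positivity)
          (by positivity)]
        congr 1
        field_simp
        ring

lemma setLIntegral_frozen_le {α β γ : Measure ℝ} [SFinite α] [SFinite β] [SFinite γ]
    (hβ : β ≤ angleMeas) (hγ : γ ≤ angleMeas) {φ : E2 → ℝ≥0∞} (hφ : Measurable φ)
    {R : Set (ℝ × ℝ × ℝ)} {y m k : ℝ} (hy : 0 ≤ y) (hk : 0 ≤ k) (hymk : 2 * y * m ≤ k ^ 2)
    (hαm : α Set.univ ≤ ENNReal.ofReal m)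
    (hR : ∫⁻ p in R, (sinDist p.2.1 p.2.2)⁻¹ ∂(α.prod (β.prod γ)) ≤ ENNReal.ofReal y) :
    ∫⁻ p in R, φ (circ p.1 + (circ p.2.1 + circ p.2.2)) ∂(α.prod (β.prod γ))
      ≤ ENNReal.ofReal k * (∫⁻ x, φ x ^ 2) ^ ((1 : ℝ) / 2) := by
  have hc := continuous_circ.measurable
  refine (setLIntegral_le_weighted _ (by fun_prop)
    (S := fun p : ℝ × ℝ × ℝ => sinDist p.2.1 p.2.2) (by fun_prop)
    (fun _ => ENNReal.ofReal_ne_top) ENNReal.ofReal_ne_top hR).trans ?_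
  set N := ∫⁻ x, φ x ^ 2
  calc _ ≤ ENNReal.ofReal y ^ ((1 : ℝ) / 2) * (2 * N * ENNReal.ofReal m) ^ ((1 : ℝ) / 2) := by
        gcongr
        exact (lintegral_prod_circ_add_circ_le α hβ hγ hc hφ).trans (by gcongr)
    _ = (ENNReal.ofReal (2 * y * m) * N) ^ ((1 : ℝ) / 2) := by
        rw [← ENNReal.mul_rpow_of_nonneg _ _ (by norm_num), ENNReal.ofReal_mul (by positivity),
          ENNReal.ofReal_mul zero_le_two, ENNReal.ofReal_ofNat]
        congr 1
        ring
    _ ≤ (ENNReal.ofReal (k ^ 2) * N) ^ ((1 : ℝ) / 2) := by gcongr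
    _ = ENNReal.ofReal k * N ^ ((1 : ℝ) / 2) := by
        rw [ENNReal.mul_rpow_of_nonneg _ _ (by norm_num),
          ENNReal.ofReal_rpow_of_nonneg (by positivity) (by norm_num), ← Real.sqrt_eq_rpow,
          Real.sqrt_sq hk]

lemma ae_mem_Ioc_of_le {β : Measure ℝ} (hβ : β ≤ angleMeas) :
    ∀ᵐ b ∂β, b ∈ Set.Ioc (-Real.pi) Real.pi :=
  ae_mono hβ (ae_restrict_mem measurableSet_Ioc)

lemma lintegral_lintegral_chain_le {α β : Measure ℝ} {f : ℝ → ℝ → ℝ≥0∞}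
    {g : ℝ → ℝ≥0∞} (hf : Measurable (uncurry f)) (hg : Measurable g) {F G : ℝ≥0∞}
    (hF : ∀ᵐ b ∂β, ∫⁻ a, f a b ∂α ≤ F) (hG : ∫⁻ b, g b ∂β ≤ G) :
    ∫⁻ b, ∫⁻ a, f a b * g b ∂α ∂β ≤ F * G := by
  calc ∫⁻ b, ∫⁻ a, f a b * g b ∂α ∂β = ∫⁻ b, (∫⁻ a, f a b ∂α) * g b ∂β := by
        refine lintegral_congr fun b => ?_
        exact lintegral_mul_const _ (hf.comp (measurable_id.prodMk measurable_const))
    _ ≤ ∫⁻ b, F * g b ∂β := by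
        refine lintegral_mono_ae ?_
        filter_upwards [hF] with b hb
        gcongr
    _ ≤ F * G := by
        rw [lintegral_const_mul _ hg]
        gcongr

/-- Integration along a chain of pairwise kernels, the last coordinate being integrated first. -/
lemma lintegral_chain_le {α β γ : Measure ℝ} [SFinite α] [SFinite β]
    {f g : ℝ → ℝ → ℝ≥0∞} (hf : Measurable (uncurry f)) (hg : Measurable (uncurry g))
    {F G : ℝ≥0∞} (hF : ∀ᵐ b ∂β, ∫⁻ a, f a b ∂α ≤ F) (hG : ∀ᵐ c ∂γ, ∫⁻ b, g b c ∂β ≤ G) :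
    ∫⁻ p, f p.2.2 p.2.1 * g p.2.1 p.1 ∂(γ.prod (β.prod α)) ≤ F * G * γ Set.univ := by
  have hf' : Measurable fun p : ℝ × ℝ × ℝ => f p.2.2 p.2.1 :=
    hf.comp ((measurable_snd.comp measurable_snd).prodMk (measurable_fst.comp measurable_snd))
  have hg' : Measurable fun p : ℝ × ℝ × ℝ => g p.2.1 p.1 :=
    hg.comp ((measurable_fst.comp measurable_snd).prodMk measurable_fst)
  rw [lintegral_prod (fun p : ℝ × ℝ × ℝ => f p.2.2 p.2.1 * g p.2.1 p.1)
    (hf'.mul hg').aemeasurable, ← lintegral_const]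
  refine lintegral_mono_ae ?_
  filter_upwards [hG] with c hc
  rw [lintegral_prod (fun p : ℝ × ℝ => f p.2 p.1 * g p.1 c)
    ((hf'.mul hg').comp measurable_prodMk_left).aemeasurable]
  exact lintegral_lintegral_chain_le hf (hg.comp (measurable_id.prodMk measurable_const)) hF hc

lemma measurePreserving_rotate (α β γ : Measure ℝ) [SFinite α] [SFinite β] [SFinite γ] :
    MeasurePreserving (fun p : ℝ × ℝ × ℝ => (p.2.1, p.2.2, p.1))
      (γ.prod (α.prod β)) (α.prod (β.prod γ)) :=
  (measurePreserving_prodAssoc α β γ).comp Measure.measurePreserving_swap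

lemma measurePreserving_swap_first (α β γ : Measure ℝ) [SFinite α] [SFinite β] [SFinite γ] :
    MeasurePreserving (fun p : ℝ × ℝ × ℝ => (p.2.1, p.1, p.2.2))
      (β.prod (α.prod γ)) (α.prod (β.prod γ)) :=
  (measurePreserving_prodAssoc α β γ).comp
    (((Measure.measurePreserving_swap (μ := β) (ν := α)).prod (MeasurePreserving.id γ)).comp
      (measurePreserving_prodAssoc β α γ).symm)

lemma measurePreserving_swap_last (α β γ : Measure ℝ) [SFinite α] [SFinite β] [SFinite γ] :
    MeasurePreserving (fun p : ℝ × ℝ × ℝ => (p.1, p.2.2, p.2.1))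
      (α.prod (γ.prod β)) (α.prod (β.prod γ)) :=
  (MeasurePreserving.id α).prod Measure.measurePreserving_swap

lemma inv_sinDist (a b : ℝ) : (sinDist a b)⁻¹ = sinWeight a b * sinWeight a b := by
  rw [← sq, sinWeight, ← ENNReal.rpow_two, ← ENNReal.rpow_mul, ← ENNReal.rpow_neg_one]
  norm_num

lemma sinDist_triangle (a b c : ℝ) : sinDist a b ≤ sinDist a c + sinDist b c := by
  rw [sinDist, sinDist, sinDist, ← ENNReal.ofReal_add (abs_nonneg _) (abs_nonneg _)]
  refine ENNReal.ofReal_le_ofReal ?_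
  rw [← sub_sub_sub_cancel_right a b c, Real.sin_sub]
  refine (abs_sub _ _).trans (add_le_add ?_ ?_)
  · rw [abs_mul]
    exact mul_le_of_le_one_right (abs_nonneg _) (Real.abs_cos_le_one _)
  · rw [abs_mul]
    exact mul_le_of_le_one_left (abs_nonneg _) (Real.abs_cos_le_one _)

lemma inv_sinDist_le_of_sinDist_le {a b c : ℝ} (h : sinDist a c ≤ sinDist b c) :
    (sinDist b c)⁻¹ ≤ 2 * (sinWeight c b * sinWeight b a) := by
  have h1 : sinDist b a ≤ 2 * sinDist b c := by
    rw [sinDist_comm b a, two_mul]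
    exact (sinDist_triangle a b c).trans (by gcongr)
  have h2 : sinWeight b c ≤ 2 * sinWeight b a := by
    have h3 : (2 : ℝ≥0∞) ^ (-(1 / 2) : ℝ) * sinWeight b c ≤ sinWeight b a := by
      rw [sinWeight, ← ENNReal.mul_rpow_of_ne_top (x := 2) (y := sinDist b c) ENNReal.ofNat_ne_top
        ENNReal.ofReal_ne_top]
      exact rpow_neg_half_le_rpow_neg_half h1
    have h4 : (1 : ℝ≥0∞) ≤ 2 * (2 : ℝ≥0∞) ^ (-(1 / 2) : ℝ) := by
      nth_rewrite 1 [← ENNReal.rpow_one 2]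
      rw [← ENNReal.rpow_add _ _ (by simp) (by simp)]
      exact ENNReal.one_le_rpow (by norm_num) (by norm_num)
    calc sinWeight b c = 1 * sinWeight b c := (one_mul _).symm
      _ ≤ 2 * (2 : ℝ≥0∞) ^ (-(1 / 2) : ℝ) * sinWeight b c := by gcongr
      _ ≤ 2 * sinWeight b a := by rw [mul_assoc]; gcongr
  calc (sinDist b c)⁻¹ = sinWeight b c * sinWeight b c := inv_sinDist b c
    _ ≤ sinWeight b c * (2 * sinWeight b a) := by gcongr
    _ = 2 * (sinWeight c b * sinWeight b a) := by rw [sinWeight_comm c b]; ring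

/-- The triples of angles whose first entry is closer to the last one than the second entry is. -/
def closerSet : Set (ℝ × ℝ × ℝ) := {p | sinDist p.1 p.2.2 ≤ sinDist p.2.1 p.2.2}

lemma measurableSet_closerSet : MeasurableSet closerSet :=
  measurableSet_le (by fun_prop) (by fun_prop)

lemma lintegral_le_two_mul_closerSet {α γ : Measure ℝ} [SFinite α] [SFinite γ]
    {φ : E2 → ℝ≥0∞} (hφ : Measurable φ) :
    ∫⁻ p, φ (circ p.1 + (circ p.2.1 + circ p.2.2)) ∂(α.prod (α.prod γ)) ≤
      2 * ∫⁻ p in closerSet, φ (circ p.1 + (circ p.2.1 + circ p.2.2)) ∂(α.prod (α.prod γ)) := by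
  have hc := continuous_circ.measurable
  set Φ : ℝ × ℝ × ℝ → ℝ≥0∞ := fun p => φ (circ p.1 + (circ p.2.1 + circ p.2.2)) with hΦ
  set σ : ℝ × ℝ × ℝ → ℝ × ℝ × ℝ := fun p => (p.2.1, p.1, p.2.2) with hσ
  have hσΦ : ∀ p, Φ (σ p) = Φ p := fun p => by
    simp only [hΦ, hσ]
    rw [add_left_comm]
  have hswap : ∫⁻ p in σ ⁻¹' closerSet, Φ p ∂(α.prod (α.prod γ))
      = ∫⁻ p in closerSet, Φ p ∂(α.prod (α.prod γ)) := by
    rw [← (measurePreserving_swap_first α α γ).setLIntegral_comp_preimage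
      measurableSet_closerSet (by fun_prop)]
    exact lintegral_congr fun p => (hσΦ p).symm
  calc ∫⁻ p, Φ p ∂(α.prod (α.prod γ))
      ≤ ∫⁻ p in closerSet ∪ σ ⁻¹' closerSet, Φ p ∂(α.prod (α.prod γ)) := by
        rw [← setLIntegral_univ]
        exact lintegral_mono_set fun p _ => le_total (sinDist p.1 p.2.2) (sinDist p.2.1 p.2.2)
    _ ≤ _ := lintegral_union_le _ _ _
    _ = _ := by rw [hswap, two_mul]

section Trilinear

variable {α γ : Measure ℝ} [SFinite α] [SFinite γ] {q q' ε : ℝ} {φ : E2 → ℝ≥0∞}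

/-- The trilinear estimate when the repeated arc is much shorter. -/
lemma lintegral_triple_le_of_short (hα : α ≤ angleMeas) (hγ : γ ≤ angleMeas)
    (hq : 0 < q) (hq' : 0 < q') (hαq : α Set.univ ≤ ENNReal.ofReal (40 * q ^ 2))
    (hγq : γ Set.univ ≤ ENNReal.ofReal (40 * q' ^ 2)) (hε : 0 < ε) (hφ : Measurable φ)
    (hqq : 4 * 10 ^ 8 * q ≤ ε ^ 2 * q') :
    ∫⁻ p, φ (circ p.1 + (circ p.2.1 + circ p.2.2)) ∂(α.prod (α.prod γ)) ≤
      ENNReal.ofReal (ε * q ^ 2 * q') * (∫⁻ x, φ x ^ 2) ^ ((1 : ℝ) / 2) := by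
  refine (lintegral_le_two_mul_closerSet hφ).trans ?_
  have hR : ∫⁻ p in closerSet, (sinDist p.2.1 p.2.2)⁻¹ ∂(α.prod (α.prod γ))
      ≤ ENNReal.ofReal (512000 * q ^ 3 * q') := by
    calc _ ≤ ∫⁻ p in closerSet, 2 * (sinWeight p.2.2 p.2.1 * sinWeight p.2.1 p.1)
            ∂(α.prod (α.prod γ)) :=
          setLIntegral_mono' measurableSet_closerSet fun p hp => inv_sinDist_le_of_sinDist_le hp
      _ ≤ ∫⁻ p, 2 * (sinWeight p.2.2 p.2.1 * sinWeight p.2.1 p.1) ∂(α.prod (α.prod γ)) :=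
          setLIntegral_le_lintegral _ _
      _ = 2 * ∫⁻ p, sinWeight p.2.2 p.2.1 * sinWeight p.2.1 p.1 ∂(α.prod (α.prod γ)) :=
          lintegral_const_mul _ (by fun_prop)
      _ ≤ 2 * (ENNReal.ofReal (80 * q') * ENNReal.ofReal (80 * q)
            * ENNReal.ofReal (40 * q ^ 2)) := by
          gcongr
          refine (lintegral_chain_le (F := ENNReal.ofReal (80 * q'))
            (G := ENNReal.ofReal (80 * q)) (f := sinWeight) (g := sinWeight)
            (measurable_fst.sinWeight measurable_snd) (measurable_fst.sinWeight measurable_snd)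
            ?_ ?_).trans (by gcongr)
          · filter_upwards [ae_mem_Ioc_of_le hα] with b hb
            exact lintegral_sinWeight_le hγ hq' hγq hb
          · filter_upwards [ae_mem_Ioc_of_le hα] with b hb
            exact lintegral_sinWeight_le hα hq hαq hb
      _ = ENNReal.ofReal (512000 * q ^ 3 * q') := by
          rw [← ENNReal.ofReal_mul (by positivity), ← ENNReal.ofReal_mul (by positivity),
            ← ENNReal.ofReal_ofNat 2, ← ENNReal.ofReal_mul (by positivity)]
          congr 1
          ring
  calc _ ≤ 2 * (ENNReal.ofReal (ε * q ^ 2 * q' / 2) * (∫⁻ x, φ x ^ 2) ^ ((1 : ℝ) / 2)) := by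
        gcongr 2 * ?_
        refine setLIntegral_frozen_le hα hγ hφ (by positivity) (by positivity) ?_ hαq hR
        have h := mul_le_mul_of_nonneg_left hqq (by positivity : 0 ≤ q ^ 4 * q' / 4)
        have h2 : 0 ≤ q ^ 5 * q' := by positivity
        linarith
    _ = _ := by
        generalize ∫⁻ x, φ x ^ 2 = N
        rw [← mul_assoc, ← ENNReal.ofReal_ofNat 2, ← ENNReal.ofReal_mul zero_le_two]
        congr 2
        ring

/-- The trilinear estimate when the repeated arc is transverse to the other one. -/
lemma lintegral_triple_le_of_transverse (hα : α ≤ angleMeas) (hγ : γ ≤ angleMeas)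
    (hq : 0 < q) (hq' : 0 < q') (hαq : α Set.univ ≤ ENNReal.ofReal (40 * q ^ 2))
    (hγq : γ Set.univ ≤ ENNReal.ofReal (40 * q' ^ 2)) (hε : 0 < ε) (hφ : Measurable φ)
    {M : ℝ} (hM : 0 < M) (hMε : 4 * 10 ^ 8 ≤ ε ^ 2 * M)
    (hsep : ∀ᵐ p ∂(α.prod γ), ENNReal.ofReal (M * q ^ 2) ≤ sinDist p.1 p.2) :
    ∫⁻ p, φ (circ p.1 + (circ p.2.1 + circ p.2.2)) ∂(α.prod (α.prod γ)) ≤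
      ENNReal.ofReal (ε * q ^ 2 * q') * (∫⁻ x, φ x ^ 2) ^ ((1 : ℝ) / 2) := by
  rw [← setLIntegral_univ]
  refine setLIntegral_frozen_le (y := 64000 * q ^ 2 * q' ^ 2 / M) hα hγ hφ
    (by positivity) (by positivity) ?_ hαq ?_
  · have h := mul_le_mul_of_nonneg_left hMε (by positivity : 0 ≤ q ^ 4 * q' ^ 2 / M)
    have h1 : q ^ 4 * q' ^ 2 / M * (ε ^ 2 * M) = (ε * q ^ 2 * q') ^ 2 := by
      field_simp
    rw [h1] at h
    have h2 : 0 ≤ q ^ 4 * q' ^ 2 / M := by positivity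
    have h3 : 2 * (64000 * q ^ 2 * q' ^ 2 / M) * (40 * q ^ 2)
        = 5120000 * (q ^ 4 * q' ^ 2 / M) := by ring
    rw [h3]
    linarith
  · rw [setLIntegral_univ, lintegral_prod _ (by fun_prop)]
    have hα' : α Set.univ * γ Set.univ ≤ ENNReal.ofReal (40 * q ^ 2 * (40 * q' ^ 2)) := by
      rw [ENNReal.ofReal_mul (by positivity)]
      gcongr
    calc _ ≤ ∫⁻ _, ENNReal.ofReal (M * q ^ 2)⁻¹ * ENNReal.ofReal (40 * q ^ 2 * (40 * q' ^ 2))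
            ∂α := by
          refine lintegral_mono fun a => ?_
          calc ∫⁻ p : ℝ × ℝ, (sinDist p.1 p.2)⁻¹ ∂(α.prod γ)
              ≤ ∫⁻ _ : ℝ × ℝ, ENNReal.ofReal (M * q ^ 2)⁻¹ ∂(α.prod γ) := by
                refine lintegral_mono_ae ?_
                filter_upwards [hsep] with p hp
                rw [ENNReal.ofReal_inv_of_pos (by positivity)]
                exact ENNReal.inv_le_inv.2 hp
            _ ≤ _ := by
                rw [lintegral_const, ← Set.univ_prod_univ, Measure.prod_prod]
                gcongr
      _ ≤ ENNReal.ofReal (M * q ^ 2)⁻¹ * ENNReal.ofReal (40 * q ^ 2 * (40 * q' ^ 2))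
            * ENNReal.ofReal (40 * q ^ 2) := by
          rw [lintegral_const]
          gcongr
      _ = _ := by
          rw [← ENNReal.ofReal_mul (by positivity), ← ENNReal.ofReal_mul (by positivity)]
          congr 1
          field_simp
          ring

/-- The trilinear estimate when the repeated arc is much longer. -/
lemma lintegral_triple_le_of_long (hα : α ≤ angleMeas) (hγ : γ ≤ angleMeas)
    (hq : 0 < q) (hq' : 0 < q') (hαq : α Set.univ ≤ ENNReal.ofReal (40 * q ^ 2))
    (hγq : γ Set.univ ≤ ENNReal.ofReal (40 * q' ^ 2)) (hε : 0 < ε) (hφ : Measurable φ)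
    (hqq : 4 * 10 ^ 8 * q' ≤ ε ^ 2 * q) :
    ∫⁻ p, φ (circ p.1 + (circ p.2.1 + circ p.2.2)) ∂(α.prod (α.prod γ)) ≤
      ENNReal.ofReal (ε * q ^ 2 * q') * (∫⁻ x, φ x ^ 2) ^ ((1 : ℝ) / 2) := by
  have hc := continuous_circ.measurable
  have hnw : Measurable (uncurry (nearWeight q')) :=
    measurable_nearWeight q' measurable_fst measurable_snd
  refine (lintegral_le_two_mul_closerSet hφ).trans ?_
  set W : Set (ℝ × ℝ × ℝ) := {p | sinDist p.1 p.2.1 < ENNReal.ofReal (q' ^ 2)} with hW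
  have hWm : MeasurableSet W := measurableSet_lt (by fun_prop) measurable_const
  set k := ε * q ^ 2 * q' / 4 with hk
  have hk0 : 0 ≤ k := by positivity
  have hkk : 2 * (256000 * q * q' ^ 3) * (40 * q ^ 2) ≤ k ^ 2 := by
    have h := mul_le_mul_of_nonneg_left hqq (by positivity : 0 ≤ q ^ 3 * q' ^ 2 / 16)
    have h2 : 0 ≤ q ^ 3 * q' ^ 3 := by positivity
    rw [hk]
    linarith
  set N := ∫⁻ x, φ x ^ 2
  have hnear : ∫⁻ p in closerSet ∩ W, φ (circ p.1 + (circ p.2.1 + circ p.2.2))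
      ∂(α.prod (α.prod γ)) ≤ ENNReal.ofReal k * N ^ ((1 : ℝ) / 2) := by
    refine setLIntegral_frozen_le hα hγ hφ (by positivity) hk0 hkk hαq ?_
    have hm : Measurable fun p : ℝ × ℝ × ℝ =>
        2 * (nearWeight q' p.1 p.2.1 * sinWeight p.2.1 p.2.2) :=
      ((hnw.comp (measurable_fst.prodMk (measurable_fst.comp measurable_snd))).mul
        (by fun_prop)).const_mul 2
    calc _ ≤ ∫⁻ p in closerSet ∩ W, 2 * (nearWeight q' p.1 p.2.1 * sinWeight p.2.1 p.2.2)
            ∂(α.prod (α.prod γ)) := by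
          refine setLIntegral_mono' (measurableSet_closerSet.inter hWm) fun p hp => ?_
          rw [nearWeight, if_pos (show sinDist p.1 p.2.1 < ENNReal.ofReal (q' ^ 2) from hp.2),
            sinWeight_comm p.1, mul_comm (sinWeight p.2.1 p.1),
            sinWeight_comm p.2.1 p.2.2]
          exact inv_sinDist_le_of_sinDist_le hp.1
      _ ≤ ∫⁻ p, 2 * (nearWeight q' p.1 p.2.1 * sinWeight p.2.1 p.2.2) ∂(α.prod (α.prod γ)) :=
          setLIntegral_le_lintegral _ _
      _ = ∫⁻ p, 2 * (nearWeight q' p.2.2 p.2.1 * sinWeight p.2.1 p.1) ∂(γ.prod (α.prod α)) := by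
          rw [← ((measurePreserving_rotate α α γ).comp
            (measurePreserving_swap_last γ α α)).lintegral_comp hm]
          rfl
      _ = 2 * ∫⁻ p, nearWeight q' p.2.2 p.2.1 * sinWeight p.2.1 p.1 ∂(γ.prod (α.prod α)) :=
          lintegral_const_mul _ ((measurable_nearWeight q' (by fun_prop) (by fun_prop)).mul
            (by fun_prop))
      _ ≤ 2 * (ENNReal.ofReal (40 * q') * ENNReal.ofReal (80 * q)
            * ENNReal.ofReal (40 * q' ^ 2)) := by
          gcongr
          refine (lintegral_chain_le (F := ENNReal.ofReal (40 * q'))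
            (G := ENNReal.ofReal (80 * q)) (g := sinWeight)
            hnw (measurable_fst.sinWeight measurable_snd) ?_ ?_).trans (by gcongr)
          · filter_upwards [ae_mem_Ioc_of_le hα] with b hb
            exact (lintegral_mono' hα le_rfl).trans (lintegral_nearWeight_le hq'.le hb)
          · filter_upwards [ae_mem_Ioc_of_le hγ] with b hb
            exact lintegral_sinWeight_le hα hq hαq hb
      _ = ENNReal.ofReal (256000 * q * q' ^ 3) := by
          rw [← ENNReal.ofReal_mul (by positivity), ← ENNReal.ofReal_mul (by positivity),
            ← ENNReal.ofReal_ofNat 2, ← ENNReal.ofReal_mul (by positivity)]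
          congr 1
          ring
  have hfar : ∫⁻ p in Wᶜ, φ (circ p.1 + (circ p.2.1 + circ p.2.2))
      ∂(α.prod (α.prod γ)) ≤ ENNReal.ofReal k * N ^ ((1 : ℝ) / 2) := by
    rw [← (measurePreserving_rotate α α γ).setLIntegral_comp_preimage hWm.compl (by fun_prop)]
    have hcomm : ∀ p : ℝ × ℝ × ℝ, φ (circ p.2.1 + (circ p.2.2 + circ p.1))
        = φ (circ p.1 + (circ p.2.1 + circ p.2.2)) := fun p => by
      congr 1; abel
    simp only [hcomm]
    set R := (fun p : ℝ × ℝ × ℝ => (p.2.1, p.2.2, p.1)) ⁻¹' Wᶜ with hRdef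
    have hRm : MeasurableSet R := hWm.compl.preimage (by fun_prop)
    refine setLIntegral_frozen_le (m := 40 * q' ^ 2) (y := 128000 * q ^ 3 * q') hα hα hφ
      (by positivity) hk0 ?_ hγq ?_
    · refine le_trans ?_ hkk
      have h2 : 0 ≤ q ^ 3 * q' ^ 3 := by positivity
      linarith
    calc _ ≤ ∫⁻ p in R, sinWeight p.2.2 p.2.1 * ENNReal.ofReal q'⁻¹ ∂(γ.prod (α.prod α)) := by
          refine setLIntegral_mono' hRm fun p hp => ?_
          rw [inv_sinDist, sinWeight_comm p.2.2]
          gcongr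
          exact sinWeight_le_of_le hq' (not_lt.1 hp)
      _ ≤ ∫⁻ p, sinWeight p.2.2 p.2.1 * ENNReal.ofReal q'⁻¹ ∂(γ.prod (α.prod α)) :=
          setLIntegral_le_lintegral _ _
      _ ≤ ENNReal.ofReal (80 * q) * (ENNReal.ofReal q'⁻¹ * ENNReal.ofReal (40 * q ^ 2))
            * ENNReal.ofReal (40 * q' ^ 2) := by
          refine (lintegral_chain_le (F := ENNReal.ofReal (80 * q))
            (G := ENNReal.ofReal q'⁻¹ * ENNReal.ofReal (40 * q ^ 2)) (f := sinWeight)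
            (g := fun _ _ => ENNReal.ofReal q'⁻¹)
            (measurable_fst.sinWeight measurable_snd) measurable_const ?_ ?_).trans (by gcongr)
          · filter_upwards [ae_mem_Ioc_of_le hα] with b hb
            exact lintegral_sinWeight_le hα hq hαq hb
          · refine ae_of_all _ fun c => ?_
            rw [lintegral_const]
            gcongr
      _ = ENNReal.ofReal (128000 * q ^ 3 * q') := by
          rw [← ENNReal.ofReal_mul (by positivity), ← ENNReal.ofReal_mul (by positivity),
            ← ENNReal.ofReal_mul (by positivity)]
          congr 1
          field_simp
          ring
  calc _ ≤ 2 * (ENNReal.ofReal k * N ^ ((1 : ℝ) / 2) + ENNReal.ofReal k * N ^ ((1 : ℝ) / 2)) := by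
        gcongr 2 * ?_
        refine (lintegral_mono_set (t := (closerSet ∩ W) ∪ Wᶜ) fun p hp => ?_).trans
          ((lintegral_union_le _ _ _).trans (add_le_add hnear hfar))
        by_cases h : p ∈ W
        · exact Or.inl ⟨hp, h⟩
        · exact Or.inr h
    _ = _ := by
        rw [← add_mul, ← mul_assoc, ← ENNReal.ofReal_add hk0 hk0, ← ENNReal.ofReal_ofNat 2,
          ← ENNReal.ofReal_mul zero_le_two]
        congr 2
        rw [hk]
        ring

end Trilinear

lemma norm_sub_inner_smul_circ_sq (a b : ℝ) :
    ‖circ a - (⟪circ b, circ a⟫ : ℝ) • circ b‖ ^ 2 = Real.sin (a - b) ^ 2 := by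
  have h : (⟪circ b, circ a⟫ : ℝ) = Real.cos (a - b) := by
    rw [E2.inner_eq, circ_zero, circ_zero, circ_one, circ_one, Real.cos_sub]
    ring
  rw [h, E2.norm_sq_eq]
  simp only [PiLp.sub_apply, PiLp.smul_apply, smul_eq_mul, circ_zero, circ_one]
  rw [Real.sin_sub, Real.cos_sub]
  have h1 := Real.sin_sq_add_cos_sq a
  have h2 := Real.sin_sq_add_cos_sq b
  have h1' : Real.sin a ^ 2 = 1 - Real.cos a ^ 2 := by linarith
  have h2' : Real.sin b ^ 2 = 1 - Real.cos b ^ 2 := by linarith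
  ring_nf
  grind

lemma angleMeas_restrict_capAngles_univ_le {z : E2} (hz : ‖z‖ = 1) {q : ℝ} (hq : 0 < q) :
    (angleMeas.restrict (capAngles z (q ^ 2))) Set.univ ≤ ENNReal.ofReal (40 * q ^ 2) := by
  obtain ⟨θ, hθ, rfl⟩ := exists_circ_eq hz
  rw [Measure.restrict_apply_univ]
  refine (measure_mono fun a ha => ?_).trans (angleMeas_sinDist_lt_le hq hθ)
  refine (ENNReal.ofReal_lt_ofReal_iff (by positivity)).2 ?_
  have h : ‖circ a - (⟪circ θ, circ a⟫ : ℝ) • circ θ‖ < q ^ 2 := ha.2.2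
  rwa [← abs_norm, sq_eq_sq_iff_abs_eq_abs _ _ |>.1 (norm_sub_inner_smul_circ_sq a θ)] at h

lemma norm_sub_le_of_mem_cap {z y : E2} (hz : ‖z‖ = 1) {r : ℝ} (hr : 0 < r)
    (hy : y ∈ cap z r) : ‖y - z‖ ≤ 2 * r := by
  obtain ⟨hy1, hpos, hlt⟩ := hy
  have hy1 : ‖y‖ = 1 := by simpa using hy1
  set c : ℝ := ⟪z, y⟫ with hc
  have hsq : ‖y - c • z‖ ^ 2 = 1 - c ^ 2 := by
    rw [norm_sub_sq_real, inner_smul_right, real_inner_comm, norm_smul, hy1, hz, ← hc,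
      Real.norm_eq_abs, mul_one, sq_abs]
    ring
  have hc1 : c ≤ 1 := by
    have := real_inner_le_norm z y
    rwa [hy1, hz, mul_one] at this
  have hcz : ‖c • z - z‖ = 1 - c := by
    rw [show c • z - z = (c - 1) • z by rw [sub_smul, one_smul], norm_smul, hz,
      Real.norm_eq_abs, abs_of_nonpos (by linarith)]
    ring
  have h1 : 1 - c ≤ r := by
    have := norm_nonneg (y - c • z)
    nlinarith
  calc ‖y - z‖ ≤ ‖y - c • z‖ + ‖c • z - z‖ := norm_sub_le_norm_sub_add_norm_sub _ _ _
    _ ≤ 2 * r := by rw [hcz]; linarith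

lemma min_norm_circ_sub_add_le (b c : ℝ) :
    min ‖circ b - circ c‖ ‖circ b + circ c‖ ≤ 2 * |Real.sin (b - c)| := by
  have h1 := Real.sin_sq_add_cos_sq (b - c)
  have h2 := Real.sin_sq_add_cos_sq b
  have h3 := Real.sin_sq_add_cos_sq c
  have h4 := Real.cos_le_one (b - c)
  have h5 := Real.neg_one_le_cos (b - c)
  have hcos := Real.cos_sub b c
  rcases le_total 0 (Real.cos (b - c)) with h | h
  · refine (min_le_left _ _).trans (abs_le_of_sq_le_sq' ?_ (by positivity)).2
    rw [mul_pow, sq_abs, E2.norm_sq_eq]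
    simp only [PiLp.sub_apply, circ_zero, circ_one]
    nlinarith
  · refine (min_le_right _ _).trans (abs_le_of_sq_le_sq' ?_ (by positivity)).2
    rw [mul_pow, sq_abs, E2.norm_sq_eq]
    simp only [PiLp.add_apply, circ_zero, circ_one]
    nlinarith

lemma le_abs_sin_of_mem_capAngles {z z' : E2} (hz : ‖z‖ = 1) (hz' : ‖z'‖ = 1) {r r' d : ℝ}
    (hr : 0 < r) (hr' : 0 < r') (h₁ : d ≤ ‖z - z'‖)
    (h₂ : d ≤ ‖-z - z'‖) {b c : ℝ} (hb : b ∈ capAngles z r) (hc : c ∈ capAngles z' r') :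
    d - 2 * r - 2 * r' ≤ 2 * |Real.sin (b - c)| := by
  have hb' := norm_sub_le_of_mem_cap hz hr hb
  have hc' := norm_sub_le_of_mem_cap hz' hr' hc
  refine le_trans (le_min ?_ ?_) (min_norm_circ_sub_add_le b c)
  · have h : z - z' = (circ b - circ c) - (circ b - z) + (circ c - z') := by abel
    have := norm_add_le ((circ b - circ c) - (circ b - z)) (circ c - z')
    have := norm_sub_le (circ b - circ c) (circ b - z)
    rw [h] at h₁
    linarith
  · have h : -z - z' = -(circ b + circ c) + (circ b - z) + (circ c - z') := by abel
    have := norm_add_le (-(circ b + circ c) + (circ b - z)) (circ c - z')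
    have := norm_add_le (-(circ b + circ c)) (circ b - z)
    rw [h] at h₂
    rw [norm_neg] at this
    linarith

lemma lintegral_conv_cap_le (z z' : E2) (r r' : ℝ) {φ : E2 → ℝ≥0∞} (hφ : Measurable φ) :
    ∫⁻ x, φ x ∂((sphMeas.restrict (cap z r)).conv
        ((sphMeas.restrict (cap z r)).conv (sphMeas.restrict (cap z' r')))) ≤
      ∫⁻ p, φ (circ p.1 + (circ p.2.1 + circ p.2.2))
        ∂((angleMeas.restrict (capAngles z r)).prod
          ((angleMeas.restrict (capAngles z r)).prod (angleMeas.restrict (capAngles z' r')))) := by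
  have hc := continuous_circ.measurable
  have hmap : ∀ (w : E2) (s : ℝ) {g : E2 → ℝ≥0∞}, Measurable g →
      ∫⁻ x, g x ∂(sphMeas.restrict (cap w s)) ≤
        ∫⁻ a, g (circ a) ∂(angleMeas.restrict (capAngles w s)) := fun w s g hg =>
    (lintegral_mono' (sphMeas_restrict_cap_le w s) le_rfl).trans (lintegral_map hg hc).le
  rw [Measure.lintegral_conv hφ, lintegral_prod _ (by fun_prop)]
  refine (hmap z r ?_).trans (lintegral_mono fun a => ?_)
  · exact Measurable.lintegral_prod_right' (f := fun p : E2 × E2 => φ (p.1 + p.2)) (by fun_prop)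
  rw [Measure.lintegral_conv (by fun_prop), lintegral_prod _ (by fun_prop)]
  refine (hmap z r ?_).trans (lintegral_mono fun b => ?_)
  · exact Measurable.lintegral_prod_right' (f := fun p : E2 × E2 => φ (circ a + (p.1 + p.2)))
      (by fun_prop)
  exact hmap z' r' (by fun_prop)

/-- The trilinear estimate for distant caps, with the separation threshold made explicit. -/
lemma lintegral_triple_capAngles_le {ε κ : ℝ} (hε : 0 < ε) (hκ : κ = 4 * 10 ^ 8 / ε ^ 2)
    {z z' : E2} (hz : ‖z‖ = 1) (hz' : ‖z'‖ = 1) {q q' : ℝ} (hq : 0 < q) (hq' : 0 < q')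
    (hd : 4 * κ ^ 2 + 2 + 2 * κ < capDistAntipodal z (q ^ 2) z' (q' ^ 2))
    {φ : E2 → ℝ≥0∞} (hφ : Measurable φ) :
    ∫⁻ p, φ (circ p.1 + (circ p.2.1 + circ p.2.2))
        ∂((angleMeas.restrict (capAngles z (q ^ 2))).prod
          ((angleMeas.restrict (capAngles z (q ^ 2))).prod
            (angleMeas.restrict (capAngles z' (q' ^ 2))))) ≤
      ENNReal.ofReal (ε * q ^ 2 * q') * (∫⁻ x, φ x ^ 2) ^ ((1 : ℝ) / 2) := by
  have hκ0 : 0 < κ := by rw [hκ]; positivity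
  have hκε : ε ^ 2 * κ = 4 * 10 ^ 8 := by rw [hκ]; field_simp
  have hα := angleMeas_restrict_capAngles_univ_le hz hq
  have hγ := angleMeas_restrict_capAngles_univ_le hz' hq'
  have hle : ∀ {s}, angleMeas.restrict s ≤ angleMeas := Measure.restrict_le_self
  by_cases h1 : κ * q ≤ q'
  · refine lintegral_triple_le_of_short hle hle hq hq' hα hγ hε hφ ?_
    rw [← hκε, mul_assoc]
    gcongr
  by_cases h2 : κ * q' ≤ q
  · refine lintegral_triple_le_of_long hle hle hq hq' hα hγ hε hφ ?_
    rw [← hκε, mul_assoc]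
    gcongr
  push Not at h1 h2
  refine lintegral_triple_le_of_transverse hle hle hq hq' hα hγ hε hφ hκ0 hκε.ge ?_
  have hr : 0 < q ^ 2 := by positivity
  have hr' : 0 < q' ^ 2 := by positivity
  have h3 : q' ^ 2 ≤ κ ^ 2 * q ^ 2 := by
    rw [← mul_pow]
    exact pow_le_pow_left₀ hq'.le h1.le 2
  have h4 : q ^ 2 ≤ κ ^ 2 * q' ^ 2 := by
    rw [← mul_pow]
    exact pow_le_pow_left₀ hq.le h2.le 2
  have h5 : q' ^ 2 / q ^ 2 ≤ κ ^ 2 := (div_le_iff₀ hr).2 h3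
  have h6 : q ^ 2 / q' ^ 2 ≤ κ ^ 2 := (div_le_iff₀ hr').2 h4
  obtain ⟨h7, h8⟩ := lt_min_iff.1 hd
  rw [capDist] at h7 h8
  have h9 : (2 * κ ^ 2 + 2 + 2 * κ) * q ^ 2 ≤ ‖z - z'‖ := by
    rw [← le_div_iff₀ hr]
    linarith
  have h10 : (2 * κ ^ 2 + 2 + 2 * κ) * q ^ 2 ≤ ‖-z - z'‖ := by
    rw [← le_div_iff₀ hr]
    linarith
  rw [Measure.prod_restrict]
  filter_upwards [ae_restrict_mem ((measurableSet_capAngles z _).prod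
    (measurableSet_capAngles z' _))] with p hp
  have h11 := le_abs_sin_of_mem_capAngles hz hz' hr hr' h9 h10 hp.1 hp.2
  exact ENNReal.ofReal_le_ofReal (by linarith)

/-- Distant caps interact weakly: if `ϱ(C, C') > ρ₀` then
`‖χ_C σ ∗ χ_C σ ∗ χ_{C'} σ‖_{L²(ℝ²)} ≤ ε |C| |C'|^{1/2}`. -/
theorem distant_caps_interact_weakly :
    ∀ ε : ℝ, 0 < ε → ∃ ρ₀ : ℝ,
      ∀ (z z' : E2) (r r' : ℝ),
        z ∈ Metric.sphere (0 : E2) 1 → z' ∈ Metric.sphere (0 : E2) 1 →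
        r ∈ Set.Ioc (0 : ℝ) 1 → r' ∈ Set.Ioc (0 : ℝ) 1 →
        ρ₀ < capDistAntipodal z r z' r' →
        eLpNorm
            (fun x => (((sphMeas.restrict (cap z r)).conv
              ((sphMeas.restrict (cap z r)).conv
                (sphMeas.restrict (cap z' r')))).rnDeriv (volume : Measure E2) x).toReal)
            2 (volume : Measure E2) ≤
          ENNReal.ofReal ε * sphMeas (cap z r) * (sphMeas (cap z' r')) ^ ((1 : ℝ) / 2) := by
  intro ε hε
  set κ : ℝ := 4 * 10 ^ 8 / ε ^ 2 with hκ
  refine ⟨4 * κ ^ 2 + 2 + 2 * κ, fun z z' r r' hz hz' hr hr' hd => ?_⟩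
  have hz : ‖z‖ = 1 := by simpa using hz
  have hz' : ‖z'‖ = 1 := by simpa using hz'
  obtain ⟨q, hq, rfl⟩ : ∃ q : ℝ, 0 < q ∧ q ^ 2 = r :=
    ⟨√r, Real.sqrt_pos.2 hr.1, Real.sq_sqrt hr.1.le⟩
  obtain ⟨q', hq', rfl⟩ : ∃ q' : ℝ, 0 < q' ∧ q' ^ 2 = r' :=
    ⟨√r', Real.sqrt_pos.2 hr'.1, Real.sq_sqrt hr'.1.le⟩
  have hK : ENNReal.ofReal (ε * q ^ 2 * q') ≤ ENNReal.ofReal ε * sphMeas (cap z (q ^ 2)) *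
      (sphMeas (cap z' (q' ^ 2))) ^ ((1 : ℝ) / 2) := by
    rw [ENNReal.ofReal_mul (by positivity), ENNReal.ofReal_mul hε.le]
    gcongr
    · refine (ENNReal.ofReal_le_ofReal ?_).trans (two_mul_le_sphMeas_cap hz hr.2)
      linarith [hr.1]
    · calc ENNReal.ofReal q' = ENNReal.ofReal (q' ^ 2) ^ ((1 : ℝ) / 2) := by
            rw [ENNReal.ofReal_rpow_of_nonneg (by positivity) (by norm_num), ← Real.sqrt_eq_rpow,
              Real.sqrt_sq hq'.le]
        _ ≤ _ := by
            gcongr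
            refine (ENNReal.ofReal_le_ofReal ?_).trans (two_mul_le_sphMeas_cap hz' hr'.2)
            linarith [hr'.1]
  refine eLpNorm_rnDeriv_le fun φ hφ => ?_
  refine (lintegral_conv_cap_le z z' _ _ hφ).trans
    ((lintegral_triple_capAngles_le hε hκ hz hz' hq hq' hd hφ).trans ?_)
  gcongr
end
end

section
/- In any metric space, for any N ≥ 2 and r > 0, any finite set S of cardinality N and diameter equal to r may be partitioned into two disjoint nonempty subsets S = S₁ ∪ S₂ such that the distance between S₁ and S₂ is at least r/(2N). Moreover, given two points s₁, s₂ ∈ S with distance(s₁, s₂) = r, this partition may be constructed so that s₁ ∈ S₁ and s₂ ∈ S₂. -/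
open Metric

/-- A nonempty finite subset of a metric space has a pair of points realizing its diameter. -/
lemma Finset.exists_dist_eq_diam {X : Type*} [PseudoMetricSpace X] {S : Finset X}
    (hS : S.Nonempty) : ∃ x ∈ S, ∃ y ∈ S, dist x y = Metric.diam (S : Set X) := by
  obtain ⟨⟨x, y⟩, hxy, hmax⟩ :=
    (S ×ˢ S).exists_max_image (fun p => dist p.1 p.2) (hS.product hS)
  rw [Finset.mem_product] at hxy
  refine ⟨x, hxy.1, y, hxy.2, le_antisymm
    (Metric.dist_le_diam_of_mem S.finite_toSet.isBounded hxy.1 hxy.2)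
    (Metric.diam_le_of_forall_dist_le dist_nonneg fun a ha b hb => ?_)⟩
  exact hmax (a, b) (Finset.mk_mem_product ha hb)

/-- Two points at positive distance `r` of a finite set `S` are separated by a partition of `S`
into two parts at distance at least `r / #S`. -/
lemma Finset.exists_partition_dist_ge {X : Type*} [PseudoMetricSpace X] [DecidableEq X]
    (S : Finset X) {s₁ s₂ : X} (h₁ : s₁ ∈ S) (h₂ : s₂ ∈ S) (hr : 0 < dist s₁ s₂) :
    ∃ S₁ S₂ : Finset X, S₁ ∪ S₂ = S ∧ Disjoint S₁ S₂ ∧ s₁ ∈ S₁ ∧ s₂ ∈ S₂ ∧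
      ∀ x ∈ S₁, ∀ y ∈ S₂, dist s₁ s₂ / S.card ≤ dist x y := by
  set r := dist s₁ s₂ with hrdef
  have hN : (0 : ℝ) < S.card := by exact_mod_cast Finset.card_pos.2 ⟨s₁, h₁⟩
  set g : X → ℕ := fun x => ⌈dist s₁ x * S.card / r⌉₊ with hg
  obtain ⟨k, hk, hkg⟩ : ∃ k ∈ Finset.range (S.card + 1), k ∉ S.image g :=
    Finset.exists_mem_notMem_of_card_lt_card <| by
      rw [Finset.card_range]
      exact Nat.lt_succ_of_le Finset.card_image_le
  have hne : ∀ x ∈ S, g x ≠ k := fun x hx h => hkg (h ▸ Finset.mem_image_of_mem g hx)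
  have hg₁ : g s₁ = 0 := by simp [hg]
  have hg₂ : g s₂ = S.card := by
    simp only [hg, ← hrdef]
    rw [mul_div_cancel_left₀ _ hr.ne', Nat.ceil_natCast]
  have hk₁ := hne s₁ h₁
  have hk₂ := hne s₂ h₂
  rw [Finset.mem_range] at hk
  refine ⟨S.filter (g · < k), S.filter (¬ g · < k), Finset.filter_union_filter_not_eq _ _,
    Finset.disjoint_filter_filter_not _ _ _, Finset.mem_filter.2 ⟨h₁, by omega⟩,
    Finset.mem_filter.2 ⟨h₂, by omega⟩, fun x hx y hy => ?_⟩
  rw [Finset.mem_filter] at hx hy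
  have hky : k < g y := lt_of_le_of_ne (not_lt.1 hy.2) (hne y hy.1).symm
  have hy' : (k : ℝ) < dist s₁ y * S.card / r := Nat.lt_ceil.1 hky
  have hx' : dist s₁ x * S.card / r ≤ g x := Nat.le_ceil _
  have hxk : (g x : ℝ) + 1 ≤ k := by exact_mod_cast hx.2
  rw [lt_div_iff₀ hr] at hy'
  rw [div_le_iff₀ hr] at hx'
  rw [div_le_iff₀ hN]
  have htri := mul_le_mul_of_nonneg_right (dist_triangle s₁ x y) hN.le
  have := mul_le_mul_of_nonneg_right hxk hr.le
  linarith

/-- In any metric space, a finite set `S` of cardinality `N ≥ 2` and diameter `r > 0`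
may be partitioned into two disjoint nonempty subsets at distance at least `r/(2N)`;
moreover, given `s₁, s₂ ∈ S` with `dist s₁ s₂ = r`, the partition may be chosen with
`s₁ ∈ S₁` and `s₂ ∈ S₂`. -/
theorem finset_partition_separated {X : Type*} [MetricSpace X] [DecidableEq X]
    (S : Finset X) (N : ℕ) (r : ℝ) (hN : 2 ≤ N) (hr : 0 < r)
    (hcard : S.card = N) (hdiam : Metric.diam (S : Set X) = r) :
    (∃ S₁ S₂ : Finset X, S₁ ∪ S₂ = S ∧ Disjoint S₁ S₂ ∧ S₁.Nonempty ∧ S₂.Nonempty ∧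
      ∀ x ∈ S₁, ∀ y ∈ S₂, r / (2 * N) ≤ dist x y) ∧
    ∀ s₁ ∈ S, ∀ s₂ ∈ S, dist s₁ s₂ = r →
      ∃ S₁ S₂ : Finset X, S₁ ∪ S₂ = S ∧ Disjoint S₁ S₂ ∧ S₁.Nonempty ∧ S₂.Nonempty ∧
        s₁ ∈ S₁ ∧ s₂ ∈ S₂ ∧ ∀ x ∈ S₁, ∀ y ∈ S₂, r / (2 * N) ≤ dist x y := by
  have key : ∀ s₁ ∈ S, ∀ s₂ ∈ S, dist s₁ s₂ = r →
      ∃ S₁ S₂ : Finset X, S₁ ∪ S₂ = S ∧ Disjoint S₁ S₂ ∧ S₁.Nonempty ∧ S₂.Nonempty ∧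
        s₁ ∈ S₁ ∧ s₂ ∈ S₂ ∧ ∀ x ∈ S₁, ∀ y ∈ S₂, r / (2 * N) ≤ dist x y := by
    intro s₁ h₁ s₂ h₂ h
    obtain ⟨S₁, S₂, hU, hD, m₁, m₂, hsep⟩ :=
      S.exists_partition_dist_ge h₁ h₂ (h.symm ▸ hr)
    refine ⟨S₁, S₂, hU, hD, ⟨s₁, m₁⟩, ⟨s₂, m₂⟩, m₁, m₂, fun x hx y hy => ?_⟩
    have hNpos : (0 : ℝ) < N := by exact_mod_cast (by omega : 0 < N)
    refine le_trans ?_ (hsep x hx y hy)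
    rw [h, hcard]
    exact div_le_div_of_nonneg_left hr.le hNpos (by linarith)
  refine ⟨?_, key⟩
  obtain ⟨s₁, h₁, s₂, h₂, h⟩ :=
    Finset.exists_dist_eq_diam (S := S) (Finset.card_pos.1 (by omega))
  obtain ⟨S₁, S₂, hU, hD, n₁, n₂, -, -, hsep⟩ := key s₁ h₁ s₂ h₂ (h.trans hdiam)
  exact ⟨S₁, S₂, hU, hD, n₁, n₂, hsep⟩
end

section
/- Localized linear restriction estimate: let 4 < q < 6 and R ≥ 1. There exist constants C = C(q, R) < ∞ and r₀ = r₀(R) > 0 such that for every 0 < r ≤ r₀ (with rR ≤ 1/2), every M > 0, and every measurable f : ℝ → ℂ supported in {|y| ≤ R} with |(1 − r²y²)^{1/4} f(y)| ≤ M for all |y| ≤ R, the function (t, x) ↦ ∫_ℝ e^{i x y + i t (√(1 − r²y²) − 1)/r²} (1 − r²y²)^{−1/4} f(y) dy satisfies ‖·‖_{L^q_{t,x}(ℝ×ℝ)} ≤ C M. -/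
open MeasureTheory Filter Function
open scoped ENNReal

noncomputable section

/-- The localized extension operator: for a density `f` supported in `{|y| ≤ R}`,
`(t, x) ↦ ∫_ℝ e^{i x y + i t (√(1 − r²y²) − 1)/r²} (1 − r²y²)^{−1/4} f(y) dy`. -/
def locExt (r : ℝ) (f : ℝ → ℂ) : ℝ × ℝ → ℂ := fun p =>
  ∫ y : ℝ,
    Complex.exp (Complex.I *
        ((p.2 * y + p.1 * ((Real.sqrt (1 - r ^ 2 * y ^ 2) - 1) / r ^ 2) : ℝ) : ℂ)) *
      (((1 - r ^ 2 * y ^ 2 : ℝ) ^ (-(1 / 4) : ℝ) : ℝ) : ℂ) * f y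

open scoped FourierTransform in
/-- The Fourier transform of an `L¹ ∩ L²` function agrees almost everywhere with the Fourier
transform defined on `L²`. -/
lemma fourier_toLp_ae_eq {g : ℝ → ℂ} (hg : Integrable g) (hg2 : MemLp g 2) :
    (𝓕 (hg2.toLp g) : Lp ℂ 2 (volume : Measure ℝ)) =ᵐ[volume] 𝓕 g := by
  have hcont : Continuous (𝓕 g) := VectorFourier.fourierIntegral_continuous
    Real.continuous_fourierChar (by fun_prop) hg
  refine ae_eq_of_integral_contDiff_smul_eq
    ((Lp.memLp _).locallyIntegrable (by norm_num)) hcont.locallyIntegrable fun φ hφ hφc => ?_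
  let φS : SchwartzMap ℝ ℂ := HasCompactSupport.toSchwartzMap (f := fun x => (φ x : ℂ))
    (hφc.comp_left (g := ((↑) : ℝ → ℂ)) rfl) (Complex.ofRealCLM.contDiff.comp hφ)
  have key := congrArg (fun T => T φS) (Lp.fourier_toTemperedDistribution_eq (hg2.toLp g))
  rw [TemperedDistribution.fourier_apply, Lp.toTemperedDistribution_apply,
    Lp.toTemperedDistribution_apply] at key
  have hφint : Integrable (fun x => (φ x : ℂ)) := φS.integrable
  calc ∫ x, φ x • (𝓕 (hg2.toLp g) : Lp ℂ 2 (volume : Measure ℝ)) x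
      = ∫ x, φS x • (𝓕 (hg2.toLp g) : Lp ℂ 2 (volume : Measure ℝ)) x := by
        refine integral_congr_ae (ae_of_all _ fun x => ?_)
        exact (Complex.coe_smul (φ x) _).symm
    _ = ∫ x, (𝓕 φS : SchwartzMap ℝ ℂ) x • (hg2.toLp g) x := key.symm
    _ = ∫ x, 𝓕 (fun x => (φ x : ℂ)) x • g x := by
        refine integral_congr_ae ?_
        filter_upwards [hg2.coeFn_toLp] with x hx
        rw [hx, SchwartzMap.fourier_coe]
        rfl
    _ = ∫ x, (φ x : ℂ) • 𝓕 g x := by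
        have := VectorFourier.integral_fourierIntegral_smul_eq_flip (L := innerₗ ℝ)
          Real.continuous_fourierChar (by fun_prop) hφint hg
        simpa using! this
    _ = ∫ x, φ x • 𝓕 g x := by simp

open scoped FourierTransform in
/-- Plancherel's inequality for integrable functions, with the frequency normalized as `e^{itu}`. -/
lemma lintegral_oscillatory_sq_le {g : ℝ → ℂ} (hg : Integrable g) :
    ∫⁻ t : ℝ, ‖∫ u : ℝ, Complex.exp (Complex.I * ((t * u : ℝ) : ℂ)) * g u‖ₑ ^ 2 ≤
      ENNReal.ofReal (2 * Real.pi) * ∫⁻ u, ‖g u‖ₑ ^ 2 := by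
  by_cases htop : ∫⁻ u, ‖g u‖ₑ ^ 2 = ∞
  · rw [htop, ENNReal.mul_top (by simpa using Real.pi_pos)]
    exact le_top
  have hsq : ∀ h : ℝ → ℂ, eLpNorm h 2 volume ^ 2 = ∫⁻ u, ‖h u‖ₑ ^ 2 := fun h => by
    have := eLpNorm_nnreal_pow_eq_lintegral (μ := (volume : Measure ℝ)) (f := h) (p := 2)
      (by norm_num)
    simpa using this
  have hg2 : MemLp g 2 := by
    refine ⟨hg.1, ?_⟩
    rw [← ENNReal.pow_lt_top_iff (n := 2) |>.trans (or_iff_left (by norm_num)), hsq]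
    exact lt_top_iff_ne_top.2 htop
  have hnorm : eLpNorm (𝓕 g) 2 volume = eLpNorm g 2 volume := by
    rw [← eLpNorm_congr_ae (fourier_toLp_ae_eq hg hg2), ← Lp.enorm_def,
      ← eLpNorm_congr_ae hg2.coeFn_toLp, ← Lp.enorm_def, ← ofReal_norm, ← ofReal_norm,
      Lp.norm_fourier_eq]
  have hexp : ∀ t : ℝ, ∫ u : ℝ, Complex.exp (Complex.I * ((t * u : ℝ) : ℂ)) * g u =
      𝓕 g ((-(2 * Real.pi))⁻¹ * t) := fun t => by
    rw [Real.fourier_eq']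
    refine integral_congr_ae (ae_of_all _ fun u => ?_)
    simp only [smul_eq_mul]
    congr 2
    have : (Real.pi : ℂ) ≠ 0 := by exact_mod_cast Real.pi_ne_zero
    simp
    field_simp
  simp_rw [hexp]
  rw [← hsq g, ← hnorm, hsq]
  have hcont : Continuous (𝓕 g) := VectorFourier.fourierIntegral_continuous
    Real.continuous_fourierChar (by fun_prop) hg
  rw [← lintegral_map (f := fun t => ‖𝓕 g t‖ₑ ^ 2) (by fun_prop) (measurable_const_mul _),
    Real.map_volume_mul_left (by simp [Real.pi_ne_zero]), lintegral_smul_measure, inv_inv, abs_neg,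
    abs_of_pos Real.two_pi_pos, smul_eq_mul]

/-- Plancherel's inequality after the change of variables `u = ψ y`. -/
lemma lintegral_oscillatory_phase_sq_le {S : Set ℝ} (hS : MeasurableSet S) {ψ ψ' : ℝ → ℝ} {δ : ℝ}
    (hδ : 0 < δ) (hψ : ∀ y ∈ S, HasDerivWithinAt ψ (ψ' y) S y) (hinj : Set.InjOn ψ S)
    (hlow : ∀ y ∈ S, δ ≤ |ψ' y|) {A : ℝ → ℂ} (hA : IntegrableOn A S) (hA1 : ∀ y, ‖A y‖ ≤ 1) :
    ∫⁻ t : ℝ, ‖∫ y in S, Complex.exp (Complex.I * ((t * ψ y : ℝ) : ℂ)) * A y‖ₑ ^ 2 ≤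
      ENNReal.ofReal (2 * Real.pi) * ((ENNReal.ofReal δ)⁻¹ * volume S) := by
  have hpos : ∀ y ∈ S, 0 < |ψ' y| := fun y hy => hδ.trans_le (hlow y hy)
  have himg : MeasurableSet (ψ '' S) :=
    hS.image_of_continuousOn_injOn (fun y hy => (hψ y hy).continuousWithinAt) hinj
  set τ := invFunOn ψ S
  have hτ : ∀ y ∈ S, τ (ψ y) = y := fun y hy => hinj.leftInvOn_invFunOn hy
  let g : ℝ → ℂ := fun u => |ψ' (τ u)|⁻¹ • A (τ u)
  have hg : IntegrableOn g (ψ '' S) := by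
    rw [integrableOn_image_iff_integrableOn_abs_deriv_smul hS hψ hinj]
    refine hA.congr_fun (fun y hy => ?_) hS
    simp only [g, hτ y hy]
    rw [smul_inv_smul₀ (hpos y hy).ne']
  have hint : ∀ t : ℝ, ∫ y in S, Complex.exp (Complex.I * ((t * ψ y : ℝ) : ℂ)) * A y =
      ∫ u, Complex.exp (Complex.I * ((t * u : ℝ) : ℂ)) * (ψ '' S).indicator g u := fun t => by
    have h1 : ∀ u, Complex.exp (Complex.I * ((t * u : ℝ) : ℂ)) * (ψ '' S).indicator g u =
        (ψ '' S).indicator (fun u => Complex.exp (Complex.I * ((t * u : ℝ) : ℂ)) * g u) u :=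
      fun u => by by_cases hu : u ∈ ψ '' S <;> simp [hu]
    simp_rw [h1]
    rw [integral_indicator himg, integral_image_eq_integral_abs_deriv_smul hS hψ hinj]
    refine setIntegral_congr_fun hS fun y hy => ?_
    simp only [g, hτ y hy]
    rw [mul_smul_comm, smul_inv_smul₀ (hpos y hy).ne']
  simp_rw [hint]
  refine (lintegral_oscillatory_sq_le (hg.integrable_indicator himg)).trans ?_
  gcongr
  calc ∫⁻ u, ‖(ψ '' S).indicator g u‖ₑ ^ 2
      = ∫⁻ u in ψ '' S, ‖g u‖ₑ ^ 2 := by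
        rw [← lintegral_indicator himg]
        refine lintegral_congr fun u => ?_
        by_cases hu : u ∈ ψ '' S <;> simp [hu]
    _ = ∫⁻ y in S, ENNReal.ofReal |ψ' y| * ‖g (ψ y)‖ₑ ^ 2 :=
        lintegral_image_eq_lintegral_abs_deriv_mul hS hψ hinj _
    _ ≤ ∫⁻ _ in S, (ENNReal.ofReal δ)⁻¹ := by
        refine setLIntegral_mono' hS fun y hy => ?_
        have hy0 := hpos y hy
        rw [← ENNReal.ofReal_inv_of_pos hδ, ← ofReal_norm, ← ENNReal.ofReal_pow (norm_nonneg _),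
          ← ENNReal.ofReal_mul hy0.le]
        refine ENNReal.ofReal_le_ofReal ?_
        simp only [g, hτ y hy, norm_smul, norm_inv, Real.norm_eq_abs, abs_abs]
        calc |ψ' y| * (|ψ' y|⁻¹ * ‖A y‖) ^ 2 ≤ |ψ' y| * (|ψ' y|⁻¹ * 1) ^ 2 := by
              gcongr; exact hA1 y
          _ = |ψ' y|⁻¹ := by field_simp
          _ ≤ δ⁻¹ := by gcongr; exact hlow y hy
    _ = (ENNReal.ofReal δ)⁻¹ * volume S := by simp

/-- The correlation at lag `h` of the density `a` modulated by `e^{itφ}`. -/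
def modCorr (a : ℝ → ℂ) (φ : ℝ → ℝ) (h t : ℝ) : ℂ :=
  ∫ y : ℝ, Complex.exp (Complex.I * ((t * (φ (y + h) - φ y) : ℝ) : ℂ)) *
    (a (y + h) * (starRingEnd ℂ) (a y))

/-- The part of `|∫ e^{i(xy + tφ(y))} a(y) dy|²` coming from lags in the set `s`. -/
def lagPart (a : ℝ → ℂ) (φ : ℝ → ℝ) (s : Set ℝ) (p : ℝ × ℝ) : ℂ :=
  ∫ h in s, Complex.exp (Complex.I * ((p.2 * h : ℝ) : ℂ)) * modCorr a φ h p.1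

lemma norm_exp_I_mul_ofReal_mul (x : ℝ) (z : ℂ) :
    ‖Complex.exp (Complex.I * (x : ℂ)) * z‖ = ‖z‖ := by
  rw [norm_mul, mul_comm Complex.I, Complex.norm_exp_ofReal_mul_I, one_mul]

section Correlation

variable {a : ℝ → ℂ} {φ φ' : ℝ → ℝ} {R : ℝ}

lemma stronglyMeasurable_modCorr (ha : Measurable a) (hφ : Measurable φ) :
    StronglyMeasurable fun p : ℝ × ℝ => modCorr a φ p.1 p.2 := by
  have hconj : Measurable (starRingEnd ℂ) := Complex.continuous_conj.measurable
  refine StronglyMeasurable.integral_prod_right' (f := fun w : (ℝ × ℝ) × ℝ =>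
    Complex.exp (Complex.I * ((w.1.2 * (φ (w.2 + w.1.1) - φ w.2) : ℝ) : ℂ)) *
      (a (w.2 + w.1.1) * (starRingEnd ℂ) (a w.2))) (Measurable.stronglyMeasurable ?_)
  fun_prop

lemma stronglyMeasurable_lagPart (ha : Measurable a) (hφ : Measurable φ) (s : Set ℝ) :
    StronglyMeasurable (lagPart a φ s) := by
  have hm := (stronglyMeasurable_modCorr ha hφ).measurable
  refine StronglyMeasurable.integral_prod_right' (f := fun w : (ℝ × ℝ) × ℝ =>
    Complex.exp (Complex.I * ((w.1.2 * w.2 : ℝ) : ℂ)) * modCorr a φ w.2 w.1.1)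
    (Measurable.stronglyMeasurable ?_)
  have : Measurable fun w : (ℝ × ℝ) × ℝ => modCorr a φ w.2 w.1.1 :=
    hm.comp (measurable_snd.prodMk (measurable_fst.comp measurable_fst))
  fun_prop

lemma measurableSet_inter_shift (R h : ℝ) :
    MeasurableSet (Set.Icc (-R) R ∩ {y | y + h ∈ Set.Icc (-R) R}) :=
  measurableSet_Icc.inter ((measurable_add_const h) measurableSet_Icc)

lemma volume_inter_shift_le (R h : ℝ) :
    volume (Set.Icc (-R) R ∩ {y | y + h ∈ Set.Icc (-R) R}) ≤ ENNReal.ofReal (2 * R) := by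
  refine (measure_mono Set.inter_subset_left).trans ?_
  rw [Real.volume_Icc, sub_neg_eq_add, two_mul]

lemma modCorr_eq_setIntegral (hsupp : ∀ y, y ∉ Set.Icc (-R) R → a y = 0) (h t : ℝ) :
    modCorr a φ h t = ∫ y in Set.Icc (-R) R ∩ {y | y + h ∈ Set.Icc (-R) R},
      Complex.exp (Complex.I * ((t * (φ (y + h) - φ y) : ℝ) : ℂ)) *
        (a (y + h) * (starRingEnd ℂ) (a y)) := by
  refine (setIntegral_eq_integral_of_forall_compl_eq_zero fun y hy => ?_).symm
  by_cases h1 : y ∈ Set.Icc (-R) R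
  · rw [hsupp (y + h) fun h2 => hy ⟨h1, h2⟩]
    simp
  · simp [hsupp y h1]

lemma norm_mul_conj_le_one (ha1 : ∀ y, ‖a y‖ ≤ 1) (y z : ℝ) :
    ‖a z * (starRingEnd ℂ) (a y)‖ ≤ 1 := by
  rw [norm_mul, RCLike.norm_conj]
  exact mul_le_one₀ (ha1 z) (norm_nonneg _) (ha1 y)

lemma norm_modCorr_le (hR : 0 ≤ R) (ha1 : ∀ y, ‖a y‖ ≤ 1)
    (hsupp : ∀ y, y ∉ Set.Icc (-R) R → a y = 0) (h t : ℝ) :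
    ‖modCorr a φ h t‖ ≤ 2 * R := by
  rw [modCorr_eq_setIntegral hsupp]
  have hvol := volume_inter_shift_le R h
  refine (norm_setIntegral_le_of_norm_le_const (C := 1) (hvol.trans_lt ENNReal.ofReal_lt_top)
    fun y _ => ?_).trans ?_
  · rw [norm_exp_I_mul_ofReal_mul]
    exact norm_mul_conj_le_one ha1 _ _
  · rw [one_mul]
    exact ENNReal.toReal_le_of_le_ofReal (by positivity) hvol

lemma modCorr_eq_zero (hsupp : ∀ y, y ∉ Set.Icc (-R) R → a y = 0) {h : ℝ} (hh : 2 * R < |h|)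
    (t : ℝ) : modCorr a φ h t = 0 := by
  have hempty : Set.Icc (-R) R ∩ {y | y + h ∈ Set.Icc (-R) R} = ∅ := by
    ext y
    simp only [Set.mem_inter_iff, Set.mem_Icc, Set.mem_ofPred_eq, Set.mem_empty_iff_false, iff_false]
    rintro ⟨⟨h1, h2⟩, h3, h4⟩
    rcases lt_abs.1 hh with h5 | h5 <;> linarith
  rw [modCorr_eq_setIntegral hsupp, hempty]
  simp

/-- Strict concavity of the phase makes its lag-`h` increment have derivative at least `|h|`. -/
lemma abs_le_abs_sub_deriv
    (hcv : ∀ y ∈ Set.Icc (-R) R, ∀ z ∈ Set.Icc (-R) R, y ≤ z → z - y ≤ φ' y - φ' z) {y h : ℝ}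
    (hy : y ∈ Set.Icc (-R) R) (hyh : y + h ∈ Set.Icc (-R) R) : |h| ≤ |φ' (y + h) - φ' y| := by
  rcases le_total 0 h with h0 | h0
  · have := hcv y hy (y + h) hyh (by linarith)
    rw [abs_of_nonneg h0, abs_sub_comm]
    exact le_trans (by linarith) (le_abs_self _)
  · have := hcv (y + h) hyh y hy (by linarith)
    rw [abs_of_nonpos h0]
    exact le_trans (by linarith) (le_abs_self _)

lemma lintegral_modCorr_sq_le (ha : Measurable a) (ha1 : ∀ y, ‖a y‖ ≤ 1)
    (hsupp : ∀ y, y ∉ Set.Icc (-R) R → a y = 0)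
    (hderiv : ∀ y ∈ Set.Icc (-R) R, HasDerivAt φ (φ' y) y)
    (hcv : ∀ y ∈ Set.Icc (-R) R, ∀ z ∈ Set.Icc (-R) R, y ≤ z → z - y ≤ φ' y - φ' z)
    {h : ℝ} (hh : h ≠ 0) :
    ∫⁻ t : ℝ, ‖modCorr a φ h t‖ₑ ^ 2 ≤
      ENNReal.ofReal (2 * Real.pi) * ((ENNReal.ofReal |h|)⁻¹ * ENNReal.ofReal (2 * R)) := by
  set S := Set.Icc (-R) R ∩ {y | y + h ∈ Set.Icc (-R) R}
  have hconj : Measurable (starRingEnd ℂ) := Complex.continuous_conj.measurable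
  have hd : ∀ y ∈ S, HasDerivAt (fun y => φ (y + h) - φ y) (φ' (y + h) - φ' y) y := fun y hy =>
    ((hderiv (y + h) hy.2).comp_add_const y h).sub (hderiv y hy.1)
  have hlow : ∀ y ∈ S, |h| ≤ |φ' (y + h) - φ' y| := fun y hy => abs_le_abs_sub_deriv hcv hy.1 hy.2
  have hsub : ∀ y ∈ S, ∀ z ∈ S, Set.Icc y z ⊆ S := fun y hy z hz w hw =>
    ⟨⟨hy.1.1.trans hw.1, hw.2.trans hz.1.2⟩, (hy.2.1.trans (by linarith [hw.1]) : -R ≤ w + h),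
      ((by linarith [hw.2] : w + h ≤ z + h).trans hz.2.2 : w + h ≤ R)⟩
  have hne : ∀ y ∈ S, ∀ z ∈ S, y < z → φ (y + h) - φ y ≠ φ (z + h) - φ z := by
    intro y hy z hz hyz heq
    obtain ⟨c, hc, hc0⟩ := exists_hasDerivAt_eq_zero (f := fun y => φ (y + h) - φ y) hyz
      (fun w hw => (hd w (hsub y hy z hz hw)).continuousAt.continuousWithinAt) heq
      fun w hw => hd w (hsub y hy z hz (Set.Ioo_subset_Icc_self hw))
    have := hlow c (hsub y hy z hz (Set.Ioo_subset_Icc_self hc))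
    rw [hc0, abs_zero] at this
    exact hh (abs_nonpos_iff.1 this)
  have hinj : Set.InjOn (fun y => φ (y + h) - φ y) S := by
    intro y hy z hz heq
    rcases lt_trichotomy y z with hyz | hyz | hyz
    · exact absurd heq (hne y hy z hz hyz)
    · exact hyz
    · exact absurd heq.symm (hne z hz y hy hyz)
  have hvol : volume S ≤ ENNReal.ofReal (2 * R) := volume_inter_shift_le R h
  have hint : IntegrableOn (fun y => a (y + h) * (starRingEnd ℂ) (a y)) S :=
    IntegrableOn.of_bound (hvol.trans_lt ENNReal.ofReal_lt_top)
      (Measurable.aestronglyMeasurable (by fun_prop)) 1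
      (ae_of_all _ fun y => norm_mul_conj_le_one ha1 _ _)
  simp_rw [modCorr_eq_setIntegral hsupp]
  refine (lintegral_oscillatory_phase_sq_le (measurableSet_inter_shift R h) (abs_pos.2 hh)
    (fun y hy => (hd y hy).hasDerivWithinAt) hinj hlow hint
    fun y => norm_mul_conj_le_one ha1 _ _).trans ?_
  gcongr

lemma integrable_exp_mul_modCorr (hR : 0 ≤ R) (ha : Measurable a) (hφ : Measurable φ)
    (ha1 : ∀ y, ‖a y‖ ≤ 1) (hsupp : ∀ y, y ∉ Set.Icc (-R) R → a y = 0) (t x : ℝ) :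
    Integrable fun h => Complex.exp (Complex.I * ((x * h : ℝ) : ℂ)) * modCorr a φ h t := by
  have hm : Measurable fun h => modCorr a φ h t :=
    (stronglyMeasurable_modCorr ha hφ).measurable.comp (measurable_id.prodMk measurable_const)
  have hon : IntegrableOn (fun h => Complex.exp (Complex.I * ((x * h : ℝ) : ℂ)) *
      modCorr a φ h t) (Set.Icc (-(2 * R)) (2 * R)) := by
    refine IntegrableOn.of_bound (by simp) (Measurable.aestronglyMeasurable (by fun_prop)) (2 * R)
      (ae_of_all _ fun h => ?_)
    rw [norm_exp_I_mul_ofReal_mul]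
    exact norm_modCorr_le hR ha1 hsupp h t
  refine (integrableOn_iff_integrable_of_support_subset fun h hh => ?_).1 hon
  by_contra hmem
  rw [Set.mem_Icc, ← abs_le, not_le] at hmem
  exact hh (by simp [modCorr_eq_zero hsupp hmem])

variable {s : Set ℝ} {ρ : ℝ}

lemma volume_lag_le (hs : ∀ h ∈ s, ρ ≤ |h| ∧ |h| ≤ 2 * ρ) : volume s ≤ ENNReal.ofReal (4 * ρ) := by
  refine (measure_mono fun h hh => abs_le.1 (hs h hh).2).trans ?_
  change volume (Set.Icc (-(2 * ρ)) (2 * ρ)) ≤ _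
  rw [Real.volume_Icc]
  exact ENNReal.ofReal_le_ofReal (by linarith)

lemma norm_lagPart_le (hR : 0 ≤ R) (hρ : 0 < ρ) (ha1 : ∀ y, ‖a y‖ ≤ 1)
    (hsupp : ∀ y, y ∉ Set.Icc (-R) R → a y = 0) (hs : ∀ h ∈ s, ρ ≤ |h| ∧ |h| ≤ 2 * ρ)
    (p : ℝ × ℝ) : ‖lagPart a φ s p‖ ≤ 8 * R * ρ := by
  have hvol := volume_lag_le hs
  refine (norm_setIntegral_le_of_norm_le_const (C := 2 * R) (hvol.trans_lt ENNReal.ofReal_lt_top)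
    fun h _ => ?_).trans ?_
  · rw [norm_exp_I_mul_ofReal_mul]
    exact norm_modCorr_le hR ha1 hsupp h _
  · have : volume.real s ≤ 4 * ρ := ENNReal.toReal_le_of_le_ofReal (by positivity) hvol
    nlinarith

lemma lintegral_lagPart_sq_le (hR : 0 ≤ R) (hρ : 0 < ρ) (ha : Measurable a) (hφ : Measurable φ)
    (ha1 : ∀ y, ‖a y‖ ≤ 1) (hsupp : ∀ y, y ∉ Set.Icc (-R) R → a y = 0)
    (hderiv : ∀ y ∈ Set.Icc (-R) R, HasDerivAt φ (φ' y) y)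
    (hcv : ∀ y ∈ Set.Icc (-R) R, ∀ z ∈ Set.Icc (-R) R, y ≤ z → z - y ≤ φ' y - φ' z)
    (hsm : MeasurableSet s) (hs : ∀ h ∈ s, ρ ≤ |h| ∧ |h| ≤ 2 * ρ) :
    ∫⁻ p : ℝ × ℝ, ‖lagPart a φ s p‖ₑ ^ 2 ≤ ENNReal.ofReal (32 * Real.pi ^ 2 * R) := by
  have hm := (stronglyMeasurable_modCorr ha hφ).measurable
  have hm2 : ∀ t, Measurable fun h => modCorr a φ h t := fun t =>
    hm.comp (measurable_id.prodMk measurable_const)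
  have hvol := volume_lag_le hs
  have hslice : ∀ t, ∫⁻ x, ‖lagPart a φ s (t, x)‖ₑ ^ 2 ≤
      ENNReal.ofReal (2 * Real.pi) * ∫⁻ h in s, ‖modCorr a φ h t‖ₑ ^ 2 := by
    intro t
    have hint : IntegrableOn (fun h => modCorr a φ h t) s :=
      IntegrableOn.of_bound (hvol.trans_lt ENNReal.ofReal_lt_top) (hm2 t).aestronglyMeasurable
        (2 * R) (ae_of_all _ fun h => norm_modCorr_le hR ha1 hsupp h t)
    have := lintegral_oscillatory_sq_le (hint.integrable_indicator hsm)
    convert! this using 1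
    · refine lintegral_congr fun x => ?_
      rw [lagPart, ← integral_indicator hsm]
      congr 2
      refine integral_congr_ae (ae_of_all _ fun h => ?_)
      by_cases hh : h ∈ s <;> simp [hh]
    · rw [← lintegral_indicator hsm]
      congr 1
      refine lintegral_congr fun h => ?_
      by_cases hh : h ∈ s <;> simp [hh]
  have hmeas : Measurable fun p : ℝ × ℝ => ‖lagPart a φ s p‖ₑ ^ 2 :=
    (stronglyMeasurable_lagPart ha hφ s).measurable.enorm.pow_const 2
  have hmeas' : Measurable fun p : ℝ × ℝ => ‖modCorr a φ p.2 p.1‖ₑ ^ 2 :=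
    (hm.comp measurable_swap).enorm.pow_const 2
  calc ∫⁻ p : ℝ × ℝ, ‖lagPart a φ s p‖ₑ ^ 2
      = ∫⁻ t, ∫⁻ x, ‖lagPart a φ s (t, x)‖ₑ ^ 2 := lintegral_prod _ hmeas.aemeasurable
    _ ≤ ∫⁻ t, ENNReal.ofReal (2 * Real.pi) * ∫⁻ h in s, ‖modCorr a φ h t‖ₑ ^ 2 :=
        lintegral_mono hslice
    _ = ENNReal.ofReal (2 * Real.pi) * ∫⁻ h in s, ∫⁻ t, ‖modCorr a φ h t‖ₑ ^ 2 := by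
        rw [lintegral_const_mul' _ _ ENNReal.ofReal_ne_top,
          lintegral_lintegral_swap hmeas'.aemeasurable]
    _ ≤ ENNReal.ofReal (2 * Real.pi) * ∫⁻ _ in s,
          ENNReal.ofReal (2 * Real.pi) * ((ENNReal.ofReal ρ)⁻¹ * ENNReal.ofReal (2 * R)) := by
        refine mul_le_mul' le_rfl (setLIntegral_mono' hsm fun h hh => ?_)
        have h0 : h ≠ 0 := abs_pos.1 (hρ.trans_le (hs h hh).1)
        refine (lintegral_modCorr_sq_le ha ha1 hsupp hderiv hcv h0).trans ?_
        gcongr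
        exact (hs h hh).1
    _ ≤ ENNReal.ofReal (2 * Real.pi) * (ENNReal.ofReal (2 * Real.pi) *
          ((ENNReal.ofReal ρ)⁻¹ * ENNReal.ofReal (2 * R)) * ENNReal.ofReal (4 * ρ)) := by
        rw [setLIntegral_const]
        gcongr
    _ = ENNReal.ofReal (32 * Real.pi ^ 2 * R) := by
        have hpi := Real.pi_pos
        rw [← ENNReal.ofReal_inv_of_pos hρ, ← ENNReal.ofReal_mul (by positivity),
          ← ENNReal.ofReal_mul (by positivity), ← ENNReal.ofReal_mul (by positivity),
          ← ENNReal.ofReal_mul (by positivity)]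
        congr 1
        field_simp
        ring

lemma extension_mul_conj_eq_integral_modCorr (ha : Measurable a) (hφ : Measurable φ)
    (haint : Integrable a) (p : ℝ × ℝ) :
    (∫ y, Complex.exp (Complex.I * ((p.2 * y + p.1 * φ y : ℝ) : ℂ)) * a y) *
        (starRingEnd ℂ) (∫ y, Complex.exp (Complex.I * ((p.2 * y + p.1 * φ y : ℝ) : ℂ)) * a y) =
      ∫ h, Complex.exp (Complex.I * ((p.2 * h : ℝ) : ℂ)) * modCorr a φ h p.1 := by
  set F : ℝ → ℂ := fun y => Complex.exp (Complex.I * ((p.2 * y + p.1 * φ y : ℝ) : ℂ)) * a y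
  have hF : Integrable F :=
    haint.mono (Measurable.aestronglyMeasurable (by fun_prop))
      (ae_of_all _ fun y => (norm_exp_I_mul_ofReal_mul _ _).le)
  have hFc : Integrable fun y => (starRingEnd ℂ) (F y) :=
    hF.mono (Complex.continuous_conj.comp_aestronglyMeasurable hF.1)
      (ae_of_all _ fun y => (RCLike.norm_conj _).le)
  have hprod : Integrable (fun w : ℝ × ℝ => (starRingEnd ℂ) (F w.1) * F (w.1 + w.2))
      (volume.prod volume) :=
    (measurePreserving_prod_add volume volume).integrable_comp_of_integrable (hFc.mul_prod hF)
  have hshift : ∀ y h, (starRingEnd ℂ) (F y) * F (y + h) =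
      Complex.exp (Complex.I * ((p.2 * h : ℝ) : ℂ)) *
        (Complex.exp (Complex.I * ((p.1 * (φ (y + h) - φ y) : ℝ) : ℂ)) *
          (a (y + h) * (starRingEnd ℂ) (a y))) := by
    intro y h
    simp only [F, map_mul, ← Complex.exp_conj, Complex.conj_I, Complex.conj_ofReal]
    rw [mul_mul_mul_comm, ← Complex.exp_add, ← mul_assoc (Complex.exp _) (Complex.exp _),
      ← Complex.exp_add, mul_comm ((starRingEnd ℂ) (a y))]
    congr 2
    push_cast
    ring
  calc (∫ y, F y) * (starRingEnd ℂ) (∫ y, F y)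
      = ∫ y, (starRingEnd ℂ) (F y) * ∫ h, F (y + h) := by
        simp_rw [integral_add_left_eq_self F]
        rw [integral_mul_const, integral_conj, mul_comm]
    _ = ∫ y, ∫ h, (starRingEnd ℂ) (F y) * F (y + h) := by simp_rw [integral_const_mul]
    _ = ∫ h, ∫ y, (starRingEnd ℂ) (F y) * F (y + h) := integral_integral_swap hprod
    _ = _ := by
        simp_rw [hshift, integral_const_mul]
        rfl

/-- The set of lags `h` with `ρ < |h| ≤ 2ρ`, where `ρ = R / 2 ^ k`. -/
def dyadicLags (R : ℝ) (k : ℕ) : Set ℝ := {h | R * 2⁻¹ ^ k < |h| ∧ |h| ≤ 2 * (R * 2⁻¹ ^ k)}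

lemma measurableSet_dyadicLags (R : ℝ) (k : ℕ) : MeasurableSet (dyadicLags R k) :=
  (measurableSet_lt measurable_const measurable_norm).inter
    (measurableSet_le measurable_norm measurable_const)

lemma pairwise_disjoint_dyadicLags (hR : 0 < R) : Pairwise (Disjoint on dyadicLags R) := by
  have key : ∀ i j, i < j → Disjoint (dyadicLags R i) (dyadicLags R j) := by
    intro i j hij
    refine Set.disjoint_left.2 fun h hi hj => ?_
    have h1 : (2⁻¹ : ℝ) ^ j ≤ 2⁻¹ ^ (i + 1) :=
      pow_le_pow_of_le_one (by norm_num) (by norm_num) hij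
    have h2 := mul_le_mul_of_nonneg_left h1 hR.le
    rw [pow_succ] at h2
    linarith [hi.1, hj.2]
  intro i j hij
  rcases lt_or_gt_of_ne hij with h | h
  · exact key i j h
  · exact (key j i h).symm

lemma mem_iUnion_dyadicLags (hR : 0 < R) {h : ℝ} (h0 : h ≠ 0) (hh : |h| ≤ 2 * R) :
    h ∈ ⋃ k, dyadicLags R k := by
  have hpos : 0 < |h| := abs_pos.2 h0
  obtain ⟨n, hn1, hn2⟩ := exists_nat_pow_near_of_lt_one (x := |h| / (2 * R)) (y := (2⁻¹ : ℝ))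
    (by positivity) (by rw [div_le_one (by positivity)]; exact hh) (by norm_num) (by norm_num)
  rw [lt_div_iff₀ (by positivity), pow_succ] at hn1
  rw [div_le_iff₀ (by positivity)] at hn2
  exact Set.mem_iUnion.2 ⟨n, by linarith, by linarith⟩

lemma hasSum_lagPart (hR : 0 < R) (ha : Measurable a) (hφ : Measurable φ)
    (ha1 : ∀ y, ‖a y‖ ≤ 1) (hsupp : ∀ y, y ∉ Set.Icc (-R) R → a y = 0) (p : ℝ × ℝ) :
    HasSum (fun k => lagPart a φ (dyadicLags R k) p)
      (∫ h, Complex.exp (Complex.I * ((p.2 * h : ℝ) : ℂ)) * modCorr a φ h p.1) := by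
  have hint := integrable_exp_mul_modCorr hR.le ha hφ ha1 hsupp p.1 p.2
  have := hasSum_integral_iUnion (measurableSet_dyadicLags R) (pairwise_disjoint_dyadicLags hR)
    hint.integrableOn
  convert! this using 1
  refine (setIntegral_eq_integral_of_ae_compl_eq_zero ?_).symm
  filter_upwards [compl_mem_ae_iff.2 (measure_singleton (0 : ℝ))] with h h0 hmem
  have : 2 * R < |h| := by
    by_contra hle
    exact hmem (mem_iUnion_dyadicLags hR h0 (not_lt.1 hle))
  simp [modCorr_eq_zero hsupp this]

end Correlation

/-- Interpolation between a uniform bound and an `L²` bound. -/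
lemma eLpNorm_le_of_norm_le_of_lintegral_sq_le {α : Type*} [MeasurableSpace α] {μ : Measure α}
    {B : α → ℂ} {D p : ℝ} {V : ℝ≥0∞} (hp : 2 ≤ p) (hD : ∀ x, ‖B x‖ ≤ D)
    (hV : ∫⁻ x, ‖B x‖ₑ ^ 2 ∂μ ≤ V) :
    eLpNorm B (ENNReal.ofReal p) μ ≤ (ENNReal.ofReal D ^ (p - 2) * V) ^ (1 / p) := by
  have hp0 : 0 < p := by linarith
  rw [eLpNorm_eq_lintegral_rpow_enorm_toReal (by simpa using hp0) ENNReal.ofReal_ne_top,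
    ENNReal.toReal_ofReal hp0.le]
  refine ENNReal.rpow_le_rpow ?_ (by positivity)
  calc ∫⁻ x, ‖B x‖ₑ ^ p ∂μ
      ≤ ∫⁻ x, ENNReal.ofReal D ^ (p - 2) * ‖B x‖ₑ ^ 2 ∂μ := by
        refine lintegral_mono fun x => ?_
        have : ‖B x‖ₑ ^ p = ‖B x‖ₑ ^ (p - 2) * ‖B x‖ₑ ^ 2 := by
          rw [← ENNReal.rpow_two, ← ENNReal.rpow_add_of_nonneg _ _ (by linarith) (by norm_num)]
          ring_nf
        rw [this]
        gcongr
        rw [← ofReal_norm]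
        exact ENNReal.ofReal_le_ofReal (hD x)
    _ = ENNReal.ofReal D ^ (p - 2) * ∫⁻ x, ‖B x‖ₑ ^ 2 ∂μ :=
        lintegral_const_mul' _ _ (ENNReal.rpow_ne_top_of_nonneg (by linarith) ENNReal.ofReal_ne_top)
    _ ≤ _ := by gcongr

/-- The triangle inequality for pointwise convergent series in `L^p`. -/
lemma eLpNorm_hasSum_le {α : Type*} [MeasurableSpace α] {μ : Measure α} {B : ℕ → α → ℂ}
    {g : α → ℂ} {p : ℝ≥0∞} (hp : 1 ≤ p) (hB : ∀ k, AEStronglyMeasurable (B k) μ)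
    (hg : ∀ x, HasSum (fun k => B k x) (g x)) :
    eLpNorm g p μ ≤ ∑' k, eLpNorm (B k) p μ := by
  refine (Lp.eLpNorm_lim_le_liminf_eLpNorm (f := fun n x => ∑ k ∈ Finset.range n, B k x)
    (fun n => Finset.aestronglyMeasurable_fun_sum _ fun k _ => hB k) g
    (ae_of_all _ fun x => (hg x).tendsto_sum_nat)).trans ?_
  refine liminf_le_of_le (by isBoundedDefault) fun b hb => ?_
  obtain ⟨n, hn⟩ := hb.exists
  refine hn.trans (le_trans ?_ (ENNReal.sum_le_tsum (Finset.range n)))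
  have : (fun x => ∑ k ∈ Finset.range n, B k x) = ∑ k ∈ Finset.range n, B k := by
    ext x; simp
  rw [this]
  exact eLpNorm_sum_le (fun k _ => hB k) hp

/-- The restriction estimate for curves `(φ(y), y)` with `φ'' ≤ -1` and bounded densities. -/
lemma exists_eLpNorm_extension_le {q R : ℝ} (hq : 4 < q) (hR : 0 < R) :
    ∃ C : ℝ≥0∞, C ≠ ∞ ∧ ∀ (a : ℝ → ℂ) (φ φ' : ℝ → ℝ), Measurable a → Measurable φ →
      (∀ y, ‖a y‖ ≤ 1) → (∀ y, y ∉ Set.Icc (-R) R → a y = 0) →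
      (∀ y ∈ Set.Icc (-R) R, HasDerivAt φ (φ' y) y) →
      (∀ y ∈ Set.Icc (-R) R, ∀ z ∈ Set.Icc (-R) R, y ≤ z → z - y ≤ φ' y - φ' z) →
      eLpNorm (fun p : ℝ × ℝ =>
          ∫ y, Complex.exp (Complex.I * ((p.2 * y + p.1 * φ y : ℝ) : ℂ)) * a y)
        (ENNReal.ofReal q) volume ≤ C := by
  obtain ⟨p, rfl⟩ : ∃ p, q = p * 2 := ⟨q / 2, by ring⟩
  have hp : 2 < p := by linarith
  have hp0 : 0 < p := by linarith
  set K : ℝ≥0∞ := (ENNReal.ofReal (8 * R * R) ^ (p - 2) *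
    ENNReal.ofReal (32 * Real.pi ^ 2 * R)) ^ (1 / p)
  set θ : ℝ≥0∞ := (2⁻¹ : ℝ≥0∞) ^ ((p - 2) * (1 / p))
  have hKtop : K ≠ ∞ := ENNReal.rpow_ne_top_of_nonneg (by positivity) (ENNReal.mul_ne_top
    (ENNReal.rpow_ne_top_of_nonneg (by linarith) ENNReal.ofReal_ne_top) ENNReal.ofReal_ne_top)
  have hθ1 : θ < 1 := ENNReal.rpow_lt_one (by norm_num)
    (mul_pos (by linarith) (by positivity))
  refine ⟨(K * (1 - θ)⁻¹) ^ (1 / 2 : ℝ), ENNReal.rpow_ne_top_of_nonneg (by norm_num)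
    (ENNReal.mul_ne_top hKtop (ENNReal.inv_ne_top.2 (tsub_pos_of_lt hθ1).ne')), ?_⟩
  intro a φ φ' ha hφ ha1 hsupp hderiv hcv
  set E : ℝ × ℝ → ℂ := fun p =>
    ∫ y, Complex.exp (Complex.I * ((p.2 * y + p.1 * φ y : ℝ) : ℂ)) * a y with hE
  have haint : Integrable a := by
    refine (integrableOn_iff_integrable_of_support_subset (s := Set.Icc (-R) R) fun y hy => ?_).1
      (IntegrableOn.of_bound (by simp) ha.aestronglyMeasurable 1 (ae_of_all _ ha1))
    by_contra hmem
    exact hy (hsupp y hmem)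
  have hsum : ∀ w, HasSum (fun k => lagPart a φ (dyadicLags R k) w)
      (E w * (starRingEnd ℂ) (E w)) := fun w => by
    rw [hE, extension_mul_conj_eq_integral_modCorr ha hφ haint]
    exact hasSum_lagPart hR ha hφ ha1 hsupp w
  have hpiece : ∀ k, eLpNorm (lagPart a φ (dyadicLags R k)) (ENNReal.ofReal p) volume ≤
      K * θ ^ k := by
    intro k
    have hρ : 0 < R * 2⁻¹ ^ k := by positivity
    have hs : ∀ h ∈ dyadicLags R k, R * 2⁻¹ ^ k ≤ |h| ∧ |h| ≤ 2 * (R * 2⁻¹ ^ k) :=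
      fun h hh => ⟨hh.1.le, hh.2⟩
    refine (eLpNorm_le_of_norm_le_of_lintegral_sq_le hp.le
      (norm_lagPart_le hR.le hρ ha1 hsupp hs)
      (lintegral_lagPart_sq_le hR.le hρ ha hφ ha1 hsupp hderiv hcv
        (measurableSet_dyadicLags R k) hs)).trans (le_of_eq ?_)
    have hhalf : ENNReal.ofReal ((2⁻¹ : ℝ) ^ k) = (2⁻¹ : ℝ≥0∞) ^ k := by
      rw [ENNReal.ofReal_pow (by norm_num), ENNReal.ofReal_inv_of_pos (by norm_num)]
      simp
    rw [← mul_assoc, ENNReal.ofReal_mul (by positivity), hhalf,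
      ENNReal.mul_rpow_of_nonneg _ _ (by linarith : 0 ≤ p - 2), mul_right_comm,
      ENNReal.mul_rpow_of_nonneg _ _ (by positivity : 0 ≤ 1 / p), ← ENNReal.rpow_mul,
      ← ENNReal.rpow_natCast, ← ENNReal.rpow_mul, mul_comm (k : ℝ), ENNReal.rpow_mul,
      ENNReal.rpow_natCast]
  have hsq : eLpNorm (fun w => E w * (starRingEnd ℂ) (E w)) (ENNReal.ofReal p) volume =
      eLpNorm E (ENNReal.ofReal (p * 2)) volume ^ (2 : ℝ) := by
    rw [ENNReal.ofReal_mul hp0.le, ← eLpNorm_norm_rpow E (by norm_num)]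
    refine eLpNorm_congr_norm_ae (ae_of_all _ fun w => ?_)
    rw [norm_mul, RCLike.norm_conj, Real.norm_of_nonneg (by positivity), Real.rpow_two, sq]
  have hbound : eLpNorm E (ENNReal.ofReal (p * 2)) volume ^ (2 : ℝ) ≤ K * (1 - θ)⁻¹ := by
    rw [← hsq]
    calc eLpNorm (fun w => E w * (starRingEnd ℂ) (E w)) (ENNReal.ofReal p) volume
        ≤ ∑' k, eLpNorm (lagPart a φ (dyadicLags R k)) (ENNReal.ofReal p) volume :=
          eLpNorm_hasSum_le (ENNReal.one_le_ofReal.2 (by linarith))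
            (fun k => (stronglyMeasurable_lagPart ha hφ _).aestronglyMeasurable) hsum
      _ ≤ ∑' k, K * θ ^ k := ENNReal.tsum_le_tsum hpiece
      _ = K * (1 - θ)⁻¹ := by rw [ENNReal.tsum_mul_left, ENNReal.tsum_geometric]
  calc eLpNorm E (ENNReal.ofReal (p * 2)) volume
      = (eLpNorm E (ENNReal.ofReal (p * 2)) volume ^ (2 : ℝ)) ^ (1 / 2 : ℝ) := by
        rw [← ENNReal.rpow_mul]; norm_num
    _ ≤ _ := ENNReal.rpow_le_rpow hbound (by norm_num)

section Phase

variable {r R : ℝ}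

lemma three_quarters_le_one_sub_sq (hr : 0 ≤ r) (hrR : r * R ≤ 1 / 2) {y : ℝ} (hy : |y| ≤ R) :
    3 / 4 ≤ 1 - r ^ 2 * y ^ 2 := by
  have h1 : r * |y| ≤ 1 / 2 := (mul_le_mul_of_nonneg_left hy hr).trans hrR
  have h2 : (r * |y|) ^ 2 ≤ (1 / 2) ^ 2 := pow_le_pow_left₀ (by positivity) h1 2
  rw [mul_pow, sq_abs] at h2
  linarith

lemma hasDerivAt_rescaled_sqrt (hr : 0 < r) {y : ℝ} (hy : 0 < 1 - r ^ 2 * y ^ 2) :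
    HasDerivAt (fun y => (Real.sqrt (1 - r ^ 2 * y ^ 2) - 1) / r ^ 2)
      (-(y / Real.sqrt (1 - r ^ 2 * y ^ 2))) y := by
  have h1 : HasDerivAt (fun y : ℝ => 1 - r ^ 2 * y ^ 2) (-(r ^ 2 * (2 * y))) y := by
    simpa using ((hasDerivAt_pow 2 y).const_mul (r ^ 2)).const_sub 1
  convert! ((h1.sqrt hy.ne').sub_const 1).div_const (r ^ 2) using 1
  have := Real.sqrt_pos.2 hy
  field_simp

lemma sub_le_div_sqrt_sub_div_sqrt {y z : ℝ} (hy : 0 < 1 - r ^ 2 * y ^ 2)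
    (hz : 0 < 1 - r ^ 2 * z ^ 2) (hyz : y ≤ z) :
    z - y ≤ -(y / Real.sqrt (1 - r ^ 2 * y ^ 2)) - -(z / Real.sqrt (1 - r ^ 2 * z ^ 2)) := by
  have hone : ∀ x, 0 < 1 - r ^ 2 * x ^ 2 → 1 ≤ (Real.sqrt (1 - r ^ 2 * x ^ 2))⁻¹ := fun x hx =>
    (one_le_inv₀ (Real.sqrt_pos.2 hx)).2 (Real.sqrt_le_one.2 (by nlinarith [sq_nonneg (r * x)]))
  have hmono : ∀ x w, 0 < 1 - r ^ 2 * w ^ 2 → x ^ 2 ≤ w ^ 2 →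
      (Real.sqrt (1 - r ^ 2 * x ^ 2))⁻¹ ≤ (Real.sqrt (1 - r ^ 2 * w ^ 2))⁻¹ := fun x w hw hxw =>
    inv_anti₀ (Real.sqrt_pos.2 hw) (Real.sqrt_le_sqrt (by gcongr))
  have huy := hone y hy
  have huz := hone z hz
  rw [div_eq_mul_inv, div_eq_mul_inv]
  rcases le_total 0 y with h0 | h0
  · have := hmono y z hz (by nlinarith)
    nlinarith
  · rcases le_total 0 z with h1 | h1
    · nlinarith
    · have := hmono z y hy (by nlinarith)
      nlinarith

end Phase

lemma norm_rpow_neg_mul_le {w M : ℝ} {z : ℂ} (hw : 3 / 4 ≤ w)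
    (hz : ‖((w ^ ((1 : ℝ) / 4) : ℝ) : ℂ) * z‖ ≤ M) :
    ‖((w ^ (-(1 / 4) : ℝ) : ℝ) : ℂ) * z‖ ≤ 2 * M := by
  have hw0 : 0 < w := by linarith
  have hsplit : w ^ (-(1 / 4) : ℝ) = w ^ (-(1 / 2) : ℝ) * w ^ ((1 : ℝ) / 4) := by
    rw [← Real.rpow_add hw0]; norm_num
  have hhalf : w ^ (-(1 / 2) : ℝ) ≤ 2 := by
    calc w ^ (-(1 / 2) : ℝ) ≤ (3 / 4 : ℝ) ^ (-(1 / 2) : ℝ) :=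
          Real.rpow_le_rpow_of_nonpos (by norm_num) hw (by norm_num)
      _ ≤ (3 / 4 : ℝ) ^ (-1 : ℝ) :=
          Real.rpow_le_rpow_of_exponent_ge (by norm_num) (by norm_num) (by norm_num)
      _ ≤ 2 := by rw [Real.rpow_neg_one]; norm_num
  rw [hsplit, Complex.ofReal_mul, mul_assoc, norm_mul, Complex.norm_real,
    Real.norm_of_nonneg (Real.rpow_nonneg hw0.le _)]
  exact mul_le_mul hhalf hz (norm_nonneg _) (by norm_num)

/-- Localized linear restriction estimate: for `4 < q < 6` and `R ≥ 1` there are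
`C < ∞` and `r₀ > 0` such that for all `0 < r ≤ r₀` with `rR ≤ 1/2`, all `M > 0`,
and all `f` supported in `{|y| ≤ R}` with `|(1 − r²y²)^{1/4} f(y)| ≤ M` there,
the `L^q_{t,x}(ℝ×ℝ)` norm of the localized extension is at most `C M`. -/
theorem localized_linear_restriction (q R : ℝ) (hq4 : 4 < q) (hq6 : q < 6) (hR : 1 ≤ R) :
    ∃ C r₀ : ℝ, 0 < C ∧ 0 < r₀ ∧
      ∀ r : ℝ, 0 < r → r ≤ r₀ → r * R ≤ 1 / 2 →
      ∀ M : ℝ, 0 < M →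
      ∀ f : ℝ → ℂ, Measurable f → support f ⊆ {y : ℝ | |y| ≤ R} →
        (∀ y : ℝ, |y| ≤ R → ‖((1 - r ^ 2 * y ^ 2 : ℝ) ^ ((1 : ℝ) / 4) : ℝ) * f y‖ ≤ M) →
        eLpNorm (locExt r f) (ENNReal.ofReal q) (volume : Measure (ℝ × ℝ)) ≤
          ENNReal.ofReal (C * M) := by
  obtain ⟨C, hC, hmain⟩ := exists_eLpNorm_extension_le (R := R) hq4 (by linarith)
  refine ⟨2 * C.toReal + 1, 1, by positivity, one_pos, fun r hr _ hrR M hM f hf hsupp hbd => ?_⟩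
  have hwt : ∀ y ∈ Set.Icc (-R) R, 3 / 4 ≤ 1 - r ^ 2 * y ^ 2 := fun y hy =>
    three_quarters_le_one_sub_sq hr.le hrR (abs_le.2 hy)
  have hzero : ∀ y, y ∉ Set.Icc (-R) R → f y = 0 := fun y hy => by
    by_contra hne
    exact hy (abs_le.1 (hsupp hne))
  let a : ℝ → ℂ := fun y =>
    ((2 * M : ℝ) : ℂ)⁻¹ * ((((1 - r ^ 2 * y ^ 2 : ℝ) ^ (-(1 / 4) : ℝ) : ℝ) : ℂ) * f y)
  have ha0 : ∀ y, y ∉ Set.Icc (-R) R → a y = 0 := fun y hy => by simp [a, hzero y hy]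
  have ha1 : ∀ y, ‖a y‖ ≤ 1 := by
    intro y
    by_cases hy : y ∈ Set.Icc (-R) R
    · have hnorm : ‖a y‖ = (2 * M)⁻¹ *
          ‖(((1 - r ^ 2 * y ^ 2 : ℝ) ^ (-(1 / 4) : ℝ) : ℝ) : ℂ) * f y‖ := by
        rw [norm_mul, norm_inv, Complex.norm_real, Real.norm_of_nonneg (by positivity)]
      rw [hnorm, inv_mul_le_one₀ (by positivity)]
      exact norm_rpow_neg_mul_le (hwt y hy) (hbd y (abs_le.2 hy))
    · simp [ha0 y hy]
  have hext : locExt r f = ((2 * M : ℝ) : ℂ) • fun p : ℝ × ℝ =>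
      ∫ y, Complex.exp (Complex.I *
        ((p.2 * y + p.1 * ((Real.sqrt (1 - r ^ 2 * y ^ 2) - 1) / r ^ 2) : ℝ) : ℂ)) * a y := by
    have hne : ((2 * M : ℝ) : ℂ) ≠ 0 := by exact_mod_cast (by positivity : 2 * M ≠ 0)
    funext p
    rw [Pi.smul_apply, smul_eq_mul, ← integral_const_mul]
    refine integral_congr_ae (ae_of_all _ fun y => ?_)
    simp only [a]
    rw [mul_left_comm, mul_inv_cancel_left₀ hne, mul_assoc]
  have hE := hmain a (fun y => (Real.sqrt (1 - r ^ 2 * y ^ 2) - 1) / r ^ 2) _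
    (by fun_prop) (by fun_prop) ha1 ha0
    (fun y hy => hasDerivAt_rescaled_sqrt hr (by linarith [hwt y hy]))
    (fun y hy z hz hyz => sub_le_div_sqrt_sub_div_sqrt (by linarith [hwt y hy])
      (by linarith [hwt z hz]) hyz)
  rw [hext, eLpNorm_const_smul, ← ofReal_norm, Complex.norm_real,
    Real.norm_of_nonneg (by positivity)]
  calc ENNReal.ofReal (2 * M) * _ ≤ ENNReal.ofReal (2 * M) * C := by gcongr
    _ = ENNReal.ofReal (2 * M * C.toReal) := by
      rw [ENNReal.ofReal_mul (p := 2 * M) (by positivity), ENNReal.ofReal_toReal hC]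
    _ ≤ ENNReal.ofReal ((2 * C.toReal + 1) * M) := ENNReal.ofReal_le_ofReal (by linarith)
end
end
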